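/- For every positive integer n, t(1,1,8,8;n) = σ(4n+9) − (2 − (−1)^n) · Σ x, where the sum Σ x is over all pairs (x,y) of integers with x ≡ 1 (mod 4) and 4n+9 = x^2 + 4y^2. -/

import Mathlib

/-- `N a b c d n` : number of integer quadruples `(x,y,z,w)` with
`n = a*x^2 + b*y^2 + c*z^2 + d*w^2`. -/
noncomputable def N (a b c d : ℕ) (n : ℕ) : ℕ :=
  Set.ncard {P : ℤ × ℤ × ℤ × ℤ |
    (n : ℤ) = a * P.1 ^ 2 + b * P.2.1 ^ 2 + c * P.2.2.1 ^ 2 + d * P.2.2.2 ^ 2}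

/-- `t a b c d n` : number of integer quadruples `(x,y,z,w)` with
`n = a*x(x-1)/2 + b*y(y-1)/2 + c*z(z-1)/2 + d*w(w-1)/2`. -/
noncomputable def t (a b c d : ℕ) (n : ℕ) : ℕ :=
  Set.ncard {P : ℤ × ℤ × ℤ × ℤ |
    (n : ℤ) = a * (P.1 * (P.1 - 1) / 2) + b * (P.2.1 * (P.2.1 - 1) / 2)
      + c * (P.2.2.1 * (P.2.2.1 - 1) / 2) + d * (P.2.2.2 * (P.2.2.2 - 1) / 2)}


noncomputable def bx (N : ℤ) : Finset ℤ := Finset.Icc (-N) N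

lemma mem_bx_of_sq {x N : ℤ} (h : x ^ 2 ≤ N) : x ∈ bx N := by
  unfold bx
  rw [Finset.mem_Icc]
  constructor <;> nlinarith [sq_nonneg (x - 1), sq_nonneg (x + 1), Int.le_self_sq x, Int.le_self_sq (-x)]

/-- triples (u,d,e), d,e>0, u^2+c d e = N -/
noncomputable def T (c N : ℤ) : Finset (ℤ × ℤ × ℤ) :=
  (bx N ×ˢ bx N ×ˢ bx N).filter
    (fun p => 0 < p.2.1 ∧ 0 < p.2.2 ∧ p.1 ^ 2 + c * (p.2.1 * p.2.2) = N)

lemma mem_T {c : ℤ} (hc : 0 < c) {N u d e : ℤ} :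
    (u, d, e) ∈ T c N ↔ 0 < d ∧ 0 < e ∧ u ^ 2 + c * (d * e) = N := by
  unfold T
  simp only [Finset.mem_filter, Finset.mem_product]
  constructor
  · exact fun h => h.2
  · rintro ⟨hd, he, h⟩
    have h1 : 0 < d * e := mul_pos hd he
    have h2 : d * e ≤ c * (d * e) := by nlinarith
    have h3 : d ≤ d * e := by nlinarith
    have h4 : e ≤ d * e := by nlinarith
    have := sq_nonneg u
    refine ⟨⟨mem_bx_of_sq (by linarith), ?_, ?_⟩, hd, he, h⟩ <;>
      (unfold bx; rw [Finset.mem_Icc]; constructor <;> linarith)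

/-- pairs (d,e), d,e>0, c d e = K -/
noncomputable def Pr (c K : ℤ) : Finset (ℤ × ℤ) :=
  (bx K ×ˢ bx K).filter (fun p => 0 < p.1 ∧ 0 < p.2 ∧ c * (p.1 * p.2) = K)

lemma mem_Pr {c : ℤ} (hc : 0 < c) {K d e : ℤ} :
    (d, e) ∈ Pr c K ↔ 0 < d ∧ 0 < e ∧ c * (d * e) = K := by
  unfold Pr
  simp only [Finset.mem_filter, Finset.mem_product]
  constructor
  · exact fun h => h.2
  · rintro ⟨hd, he, h⟩
    have h1 : 0 < d * e := mul_pos hd he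
    have h2 : d * e ≤ c * (d * e) := by nlinarith
    have h3 : d ≤ d * e := by nlinarith
    have h4 : e ≤ d * e := by nlinarith
    refine ⟨⟨?_, ?_⟩, hd, he, h⟩ <;>
      (unfold bx; rw [Finset.mem_Icc]; constructor <;> linarith)

/-- grouping T by u -/
lemma sum_T {c : ℤ} (hc : 0 < c) (N : ℤ) (f : ℤ × ℤ × ℤ → ℤ) :
    ∑ p ∈ T c N, f p = ∑ u ∈ bx N, ∑ q ∈ Pr c (N - u ^ 2), f (u, q) := by
  apply Finset.sum_finset_product
  rintro ⟨u, d, e⟩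
  rw [mem_T hc, mem_Pr hc]
  constructor
  · rintro ⟨hd, he, h⟩
    have h1 : 0 < c * (d * e) := by positivity
    exact ⟨mem_bx_of_sq (by linarith), hd, he, by linarith⟩
  · rintro ⟨-, hd, he, h⟩
    exact ⟨hd, he, by linarith⟩

lemma sum_T_filter {c : ℤ} (hc : 0 < c) (N : ℤ) (r : ℤ → Prop) [DecidablePred r] (f : ℤ × ℤ × ℤ → ℤ) :
    ∑ p ∈ (T c N).filter (fun p => r p.1), f p
      = ∑ u ∈ (bx N).filter r, ∑ q ∈ Pr c (N - u ^ 2), f (u, q) := by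
  apply Finset.sum_finset_product
  rintro ⟨u, d, e⟩
  simp only [Finset.mem_filter]
  rw [mem_T hc, mem_Pr hc]
  constructor
  · rintro ⟨⟨hd, he, h⟩, hr⟩
    have h1 : 0 < c * (d * e) := by positivity
    exact ⟨⟨mem_bx_of_sq (by linarith), hr⟩, hd, he, by linarith⟩
  · rintro ⟨⟨-, hr⟩, hd, he, h⟩
    exact ⟨⟨hd, he, by linarith⟩, hr⟩

lemma T_neg {c : ℤ} (hc : 0 < c) (N : ℤ) (f : ℤ → ℤ → ℤ → ℤ) :
    ∑ p ∈ T c N, f p.1 p.2.1 p.2.2 = ∑ p ∈ T c N, f (-p.1) p.2.1 p.2.2 := by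
  refine Finset.sum_nbij' (fun p => (-p.1, p.2.1, p.2.2)) (fun p => (-p.1, p.2.1, p.2.2)) ?_ ?_ ?_ ?_ ?_
  · rintro ⟨u, d, e⟩; simp only [mem_T hc]; intro h; simpa using h
  · rintro ⟨u, d, e⟩; simp only [mem_T hc]; intro h; simpa using h
  · rintro ⟨u, d, e⟩ _; simp
  · rintro ⟨u, d, e⟩ _; simp
  · rintro ⟨u, d, e⟩ _; simp

lemma T_swap {c : ℤ} (hc : 0 < c) (N : ℤ) (f : ℤ → ℤ → ℤ → ℤ) :
    ∑ p ∈ T c N, f p.1 p.2.1 p.2.2 = ∑ p ∈ T c N, f p.1 p.2.2 p.2.1 := by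
  refine Finset.sum_nbij' (fun p => (p.1, p.2.2, p.2.1)) (fun p => (p.1, p.2.2, p.2.1)) ?_ ?_ ?_ ?_ ?_
  · rintro ⟨u, d, e⟩; simp only [mem_T hc]; rintro ⟨h1, h2, h3⟩; exact ⟨h2, h1, by linarith⟩
  · rintro ⟨u, d, e⟩; simp only [mem_T hc]; rintro ⟨h1, h2, h3⟩; exact ⟨h2, h1, by linarith⟩
  · rintro ⟨u, d, e⟩ _; simp
  · rintro ⟨u, d, e⟩ _; simp
  · rintro ⟨u, d, e⟩ _; simp

lemma sq_mod8 (x : ℤ) : x ^ 2 % 8 = 0 ∨ x ^ 2 % 8 = 1 ∨ x ^ 2 % 8 = 4 := by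
  have : x % 8 = 0 ∨ x % 8 = 1 ∨ x % 8 = 2 ∨ x % 8 = 3 ∨ x % 8 = 4 ∨ x % 8 = 5 ∨ x % 8 = 6 ∨ x % 8 = 7 := by omega
  rcases this with h | h | h | h | h | h | h | h <;> simp [pow_two, Int.mul_emod, h]

lemma sq_odd_mod8 {x : ℤ} (hx : x % 2 = 1) : x ^ 2 % 8 = 1 := by
  have : x % 8 = 1 ∨ x % 8 = 3 ∨ x % 8 = 5 ∨ x % 8 = 7 := by omega
  rcases this with h | h | h | h <;> simp [pow_two, Int.mul_emod, h]

lemma sq_even_mod4 {x : ℤ} (hx : x % 2 = 0) : x ^ 2 % 4 = 0 := by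
  have : x % 4 = 0 ∨ x % 4 = 2 := by omega
  rcases this with h | h <;> simp [pow_two, Int.mul_emod, h]

/-! ### Liouville identity for four squares -/

lemma L3_core {N : ℤ} (hN : N % 8 = 5) :
    2 * ∑ p ∈ T 4 N, (p.2.2 - p.1) ^ 3 = ∑ p ∈ T 4 N, (p.2.1 + p.2.2) ^ 3 := by
  have hc : (0 : ℤ) < 4 := by norm_num
  -- first region
  have h1 : ∑ p ∈ (T 4 N).filter (fun p => p.2.2 < p.2.1 + p.1), (p.2.2 - p.1) ^ 3 = 0 := by
    have : ∑ p ∈ (T 4 N).filter (fun p => p.2.2 < p.2.1 + p.1), (p.2.2 - p.1) ^ 3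
       = ∑ p ∈ (T 4 N).filter (fun p => p.2.2 < p.2.1 + p.1), -(p.2.2 - p.1) ^ 3 := by
      refine Finset.sum_nbij' (fun p => (2 * p.2.2 - p.1, p.2.1 + p.1 - p.2.2, p.2.2))
        (fun p => (2 * p.2.2 - p.1, p.2.1 + p.1 - p.2.2, p.2.2)) ?_ ?_ ?_ ?_ ?_
      · rintro ⟨u, d, e⟩
        simp only [Finset.mem_filter, mem_T hc]
        rintro ⟨⟨h1, h2, h3⟩, h4⟩
        exact ⟨⟨by linarith, h2, by linarith⟩, by linarith⟩
      · rintro ⟨u, d, e⟩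
        simp only [Finset.mem_filter, mem_T hc]
        rintro ⟨⟨h1, h2, h3⟩, h4⟩
        exact ⟨⟨by linarith, h2, by linarith⟩, by linarith⟩
      · rintro ⟨u, d, e⟩ _; simp; ring
      · rintro ⟨u, d, e⟩ _; simp; ring
      · rintro ⟨u, d, e⟩ _; simp; ring
    rw [Finset.sum_neg_distrib] at this
    linarith
  have h2 : ∑ p ∈ (T 4 N).filter (fun p => ¬ p.2.2 < p.2.1 + p.1), (p.2.2 - p.1) ^ 3
      = ∑ p ∈ (T 4 N).filter (fun p => p.2.1 < p.2.2 + p.1), (p.2.1 + p.2.2) ^ 3 := by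
    refine Finset.sum_nbij' (fun p => (p.1 + 2 * p.2.1, p.2.1, p.2.2 - p.1 - p.2.1))
        (fun p => (p.1 - 2 * p.2.1, p.2.1, p.2.2 + p.1 - p.2.1)) ?_ ?_ ?_ ?_ ?_
    · rintro ⟨u, d, e⟩
      simp only [Finset.mem_filter, mem_T hc]
      rintro ⟨⟨h1, h2, h3⟩, h4⟩
      have h5 : d + u ≠ e := by
        intro h
        have h6 : (d + e) ^ 2 = N := by rw [← h3, ← h]; ring
        have := sq_mod8 (d + e)
        omega
      have h6 : d + u < e := by omega
      exact ⟨⟨h1, by linarith, by linarith⟩, by linarith⟩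
    · rintro ⟨u, d, e⟩
      simp only [Finset.mem_filter, mem_T hc]
      rintro ⟨⟨h1, h2, h3⟩, h4⟩
      exact ⟨⟨h1, by linarith, by linarith⟩, by linarith⟩
    · rintro ⟨u, d, e⟩ _; simp; ring
    · rintro ⟨u, d, e⟩ _; simp; ring
    · rintro ⟨u, d, e⟩ _; simp
  have h3 : ∑ p ∈ (T 4 N).filter (fun p => p.2.1 < p.2.2 + p.1), (p.2.1 + p.2.2) ^ 3
      = ∑ p ∈ (T 4 N).filter (fun p => ¬ p.2.1 < p.2.2 + p.1), (p.2.1 + p.2.2) ^ 3 := by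
    refine Finset.sum_nbij' (fun p => (-p.1, p.2.2, p.2.1))
        (fun p => (-p.1, p.2.2, p.2.1)) ?_ ?_ ?_ ?_ ?_
    · rintro ⟨u, d, e⟩
      simp only [Finset.mem_filter, mem_T hc]
      rintro ⟨⟨h1, h2, h3⟩, h4⟩
      exact ⟨⟨h2, h1, by linarith⟩, by linarith⟩
    · rintro ⟨u, d, e⟩
      simp only [Finset.mem_filter, mem_T hc]
      rintro ⟨⟨h1, h2, h3⟩, h4⟩
      have h5 : d ≠ e + u := by
        intro h
        have h6 : (d + e) ^ 2 = N := by rw [← h3, h]; ring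
        have := sq_mod8 (d + e)
        omega
      exact ⟨⟨h2, h1, by linarith⟩, by omega⟩
    · rintro ⟨u, d, e⟩ _; simp
    · rintro ⟨u, d, e⟩ _; simp
    · rintro ⟨u, d, e⟩ _; simp; ring
  have e1 := Finset.sum_filter_add_sum_filter_not (T 4 N) (fun p => p.2.2 < p.2.1 + p.1) (fun p => (p.2.2 - p.1) ^ 3)
  have e2 := Finset.sum_filter_add_sum_filter_not (T 4 N) (fun p => p.2.1 < p.2.2 + p.1) (fun p => (p.2.1 + p.2.2) ^ 3)
  linarith

lemma L3 {N : ℤ} (hN : N % 8 = 5) :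
    ∑ p ∈ T 4 N, (N - 5 * p.1 ^ 2) * p.2.1 = 0 := by
  have hc : (0 : ℤ) < 4 := by norm_num
  have h := L3_core hN
  have a1 := T_swap hc N (fun u d e => d ^ 3)
  have a2 := T_neg hc N (fun u d e => e ^ 2 * u)
  have a3 := T_neg hc N (fun u d e => u ^ 3)
  have a4 := T_swap hc N (fun u d e => d * u ^ 2)
  have a5 := T_swap hc N (fun u d e => d ^ 2 * e)
  have b1 : ∑ p ∈ T 4 N, (p.2.2 - p.1) ^ 3 = ∑ p ∈ T 4 N, p.2.2 ^ 3
     - 3 * ∑ p ∈ T 4 N, p.2.2 ^ 2 * p.1 + 3 * ∑ p ∈ T 4 N, p.2.2 * p.1 ^ 2 - ∑ p ∈ T 4 N, p.1 ^ 3 := by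
    simp only [Finset.mul_sum, ← Finset.sum_sub_distrib, ← Finset.sum_add_distrib]
    exact Finset.sum_congr rfl fun p _ => by ring
  have b2 : ∑ p ∈ T 4 N, (p.2.1 + p.2.2) ^ 3 = ∑ p ∈ T 4 N, p.2.1 ^ 3
     + 3 * ∑ p ∈ T 4 N, p.2.1 ^ 2 * p.2.2 + 3 * ∑ p ∈ T 4 N, p.2.2 ^ 2 * p.2.1 + ∑ p ∈ T 4 N, p.2.2 ^ 3 := by
    simp only [Finset.mul_sum, ← Finset.sum_add_distrib]
    exact Finset.sum_congr rfl fun p _ => by ring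
  have b3 : ∑ p ∈ T 4 N, (N - 5 * p.1 ^ 2) * p.2.1 =
     4 * ∑ p ∈ T 4 N, p.2.1 ^ 2 * p.2.2 - 4 * ∑ p ∈ T 4 N, p.2.1 * p.1 ^ 2 := by
    simp only [Finset.mul_sum, ← Finset.sum_sub_distrib]
    refine Finset.sum_congr rfl ?_
    rintro ⟨u, d, e⟩ hp
    rw [mem_T hc] at hp
    simp only
    rw [← hp.2.2]; ring
  have a2' : ∑ p ∈ T 4 N, p.2.2 ^ 2 * (-p.1) = -∑ p ∈ T 4 N, p.2.2 ^ 2 * p.1 := by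
    rw [← Finset.sum_neg_distrib]; exact Finset.sum_congr rfl fun p _ => by ring
  have a3' : ∑ p ∈ T 4 N, (-p.1) ^ 3 = -∑ p ∈ T 4 N, p.1 ^ 3 := by
    rw [← Finset.sum_neg_distrib]; exact Finset.sum_congr rfl fun p _ => by ring
  linarith

lemma L3' {N : ℤ} (hN : N % 8 = 5) :
    ∑ p ∈ (T 4 N).filter (fun p => p.1 % 4 = 1), (N - 5 * p.1 ^ 2) * p.2.1 = 0 := by
  have hc : (0 : ℤ) < 4 := by norm_num
  have h := L3 hN
  rw [← Finset.sum_filter_add_sum_filter_not (T 4 N) (fun p => p.1 % 4 = 1)] at h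
  have h3 : ∑ p ∈ (T 4 N).filter (fun p => p.1 % 4 = 1), (N - 5 * p.1 ^ 2) * p.2.1
      = ∑ p ∈ (T 4 N).filter (fun p => ¬ p.1 % 4 = 1), (N - 5 * p.1 ^ 2) * p.2.1 := by
    refine Finset.sum_nbij' (fun p => (-p.1, p.2.1, p.2.2))
        (fun p => (-p.1, p.2.1, p.2.2)) ?_ ?_ ?_ ?_ ?_
    · rintro ⟨u, d, e⟩
      simp only [Finset.mem_filter, mem_T hc]
      rintro ⟨⟨h1, h2, h3⟩, h4⟩
      exact ⟨⟨h1, h2, by linarith⟩, by omega⟩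
    · rintro ⟨u, d, e⟩
      simp only [Finset.mem_filter, mem_T hc]
      rintro ⟨⟨h1, h2, h3⟩, h4⟩
      have : u % 2 = 1 := by
        by_contra h5
        have := sq_even_mod4 (x := u) (by omega)
        omega
      exact ⟨⟨h1, h2, by linarith⟩, by omega⟩
    · rintro ⟨u, d, e⟩ _; simp
    · rintro ⟨u, d, e⟩ _; simp
    · rintro ⟨u, d, e⟩ _; simp
  linarith


noncomputable def chi (d : ℤ) : ℤ := if d % 4 = 1 then 1 else if d % 4 = 3 then -1 else 0
noncomputable def sg (e : ℤ) : ℤ := if e % 2 = 0 then 1 else -1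

lemma chi_congr {a b : ℤ} (h : a % 4 = b % 4) : chi a = chi b := by unfold chi; rw [h]
lemma chi_anti {a b : ℤ} (h : (a + b) % 4 = 0) : chi a = - chi b := by
  unfold chi; split_ifs <;> omega
lemma chi_anti2 {a b : ℤ} (ha : a % 2 = 1) (h : (a - b) % 4 = 2) : chi a = - chi b := by
  unfold chi; split_ifs <;> omega
lemma chi_even {a : ℤ} (ha : ¬ a % 2 = 1) : chi a = 0 := by
  unfold chi; split_ifs <;> omega
lemma sg_congr {a b : ℤ} (h : (a - b) % 2 = 0) : sg a = sg b := by
  unfold sg; split_ifs <;> omega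
lemma sg_anti {a b : ℤ} (h : (a - b) % 2 = 1) : sg a = - sg b := by
  unfold sg; split_ifs <;> omega

lemma mul_mod4_one {d e : ℤ} (h : (d * e) % 4 = 1) : d % 2 = 1 ∧ e % 2 = 1 ∧ d % 4 = e % 4 := by
  have h1 : d % 4 = 0 ∨ d % 4 = 1 ∨ d % 4 = 2 ∨ d % 4 = 3 := by omega
  have h2 : e % 4 = 0 ∨ e % 4 = 1 ∨ e % 4 = 2 ∨ e % 4 = 3 := by omega
  rcases h1 with h1 | h1 | h1 | h1 <;> rcases h2 with h2 | h2 | h2 | h2 <;>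
    simp [Int.mul_emod, h1, h2] at h <;> omega
lemma mul_mod4_three {d e : ℤ} (h : (d * e) % 4 = 3) : d % 2 = 1 ∧ e % 2 = 1 ∧ (d + e) % 4 = 0 := by
  have h1 : d % 4 = 0 ∨ d % 4 = 1 ∨ d % 4 = 2 ∨ d % 4 = 3 := by omega
  have h2 : e % 4 = 0 ∨ e % 4 = 1 ∨ e % 4 = 2 ∨ e % 4 = 3 := by omega
  rcases h1 with h1 | h1 | h1 | h1 <;> rcases h2 with h2 | h2 | h2 | h2 <;>
    simp [Int.mul_emod, h1, h2] at h <;> omega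

lemma L1_aux {N u d e : ℤ} (hN : N % 8 = 3) (h : u ^ 2 + 2 * (d * e) = N) :
    u % 2 = 1 ∧ d % 2 = 1 ∧ e % 2 = 1 ∧ d % 4 = e % 4 := by
  have hu : u % 2 = 1 := by
    by_contra h5
    have := sq_even_mod4 (x := u) (by omega)
    omega
  have := sq_odd_mod8 hu
  exact ⟨hu, mul_mod4_one (by omega)⟩

lemma L1_aux2 {N i d e : ℤ} (hN : N % 8 = 3) (h : i ^ 2 + 1 * (d * e) = N) (hi : i % 2 = 0) :
    d % 2 = 1 ∧ e % 2 = 1 ∧ (d + e) % 4 = 0 := by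
  have := sq_even_mod4 hi
  exact mul_mod4_three (by omega)

lemma L1_core {N : ℤ} (hN : N % 8 = 3) :
    ∑ p ∈ T 2 N, 2 * (p.2.2 - p.1) * (p.2.1 + p.1) * chi p.2.1 = 0 := by
  have hc : (0 : ℤ) < 2 := by norm_num
  have hc1 : (0 : ℤ) < 1 := by norm_num
  have h1 : ∑ p ∈ (T 2 N).filter (fun p => 2 * p.2.2 < p.2.1 + 2 * p.1), 2 * (p.2.2 - p.1) * (p.2.1 + p.1) * chi p.2.1 = 0 := by
    have : ∑ p ∈ (T 2 N).filter (fun p => 2 * p.2.2 < p.2.1 + 2 * p.1), 2 * (p.2.2 - p.1) * (p.2.1 + p.1) * chi p.2.1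
       = ∑ p ∈ (T 2 N).filter (fun p => 2 * p.2.2 < p.2.1 + 2 * p.1), -(2 * (p.2.2 - p.1) * (p.2.1 + p.1) * chi p.2.1) := by
      refine Finset.sum_nbij' (fun p => (2 * p.2.2 - p.1, p.2.1 + 2 * p.1 - 2 * p.2.2, p.2.2))
        (fun p => (2 * p.2.2 - p.1, p.2.1 + 2 * p.1 - 2 * p.2.2, p.2.2)) ?_ ?_ ?_ ?_ ?_
      · rintro ⟨u, d, e⟩
        simp only [Finset.mem_filter, mem_T hc]
        rintro ⟨⟨h1, h2, h3⟩, h4⟩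
        exact ⟨⟨by linarith, h2, by linarith⟩, by linarith⟩
      · rintro ⟨u, d, e⟩
        simp only [Finset.mem_filter, mem_T hc]
        rintro ⟨⟨h1, h2, h3⟩, h4⟩
        exact ⟨⟨by linarith, h2, by linarith⟩, by linarith⟩
      · rintro ⟨u, d, e⟩ _; simp; ring
      · rintro ⟨u, d, e⟩ _; simp; ring
      · rintro ⟨u, d, e⟩
        simp only [Finset.mem_filter, mem_T hc]
        rintro ⟨⟨h1, h2, h3⟩, h4⟩
        obtain ⟨a1, a2, a3, a4⟩ := L1_aux hN h3
        rw [chi_congr (show (d + 2 * u - 2 * e) % 4 = d % 4 by omega)]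
        ring
    rw [Finset.sum_neg_distrib] at this
    linarith
  have h2 : ∑ p ∈ (T 2 N).filter (fun p => ¬ 2 * p.2.2 < p.2.1 + 2 * p.1), 2 * (p.2.2 - p.1) * (p.2.1 + p.1) * chi p.2.1
      = ∑ p ∈ ((T 1 N).filter (fun p => p.1 % 2 = 0)).filter (fun p => p.2.1 < p.2.2 + 2 * p.1), (p.2.1 + p.2.2) * p.1 * chi p.2.1 := by
    refine Finset.sum_nbij' (fun p => (p.1 + p.2.1, p.2.1, 2 * p.2.2 - 2 * p.1 - p.2.1))
        (fun p => (p.1 - p.2.1, p.2.1, (p.2.2 + 2 * p.1 - p.2.1) / 2)) ?_ ?_ ?_ ?_ ?_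
    · rintro ⟨u, d, e⟩
      simp only [Finset.mem_filter, mem_T hc, mem_T hc1]
      rintro ⟨⟨h1, h2, h3⟩, h4⟩
      obtain ⟨a1, a2, a3, a4⟩ := L1_aux hN h3
      exact ⟨⟨⟨h1, by omega, by linarith⟩, by omega⟩, by linarith⟩
    · rintro ⟨u, d, e⟩
      simp only [Finset.mem_filter, mem_T hc, mem_T hc1]
      rintro ⟨⟨⟨h1, h2, h3⟩, h5⟩, h4⟩
      obtain ⟨a1, a2, a3⟩ := L1_aux2 hN h3 h5
      obtain ⟨k, hk⟩ : ∃ k, e + 2 * u - d = 2 * k := ⟨(e + 2 * u - d) / 2, by omega⟩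
      rw [hk, Int.mul_ediv_cancel_left _ (by norm_num)]
      have : e = 2 * k - 2 * u + d := by linarith
      subst this
      exact ⟨⟨h1, by linarith, by linarith⟩, by linarith⟩
    · rintro ⟨u, d, e⟩ _
      simp only [Prod.mk.injEq, true_and]; constructor <;> omega
    · rintro ⟨u, d, e⟩
      simp only [Finset.mem_filter, mem_T hc, mem_T hc1]
      rintro ⟨⟨⟨h1, h2, h3⟩, h5⟩, h4⟩
      obtain ⟨a1, a2, a3⟩ := L1_aux2 hN h3 h5
      simp only [Prod.mk.injEq, true_and]; constructor <;> omega
    · rintro ⟨u, d, e⟩ _; simp only; ring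
  have h3 : ∑ p ∈ ((T 1 N).filter (fun p => p.1 % 2 = 0)).filter (fun p => p.2.1 < p.2.2 + 2 * p.1), (p.2.1 + p.2.2) * p.1 * chi p.2.1
      = ∑ p ∈ ((T 1 N).filter (fun p => p.1 % 2 = 0)).filter (fun p => ¬ p.2.1 < p.2.2 + 2 * p.1), (p.2.1 + p.2.2) * p.1 * chi p.2.1 := by
    refine Finset.sum_nbij' (fun p => (-p.1, p.2.2, p.2.1))
        (fun p => (-p.1, p.2.2, p.2.1)) ?_ ?_ ?_ ?_ ?_
    · rintro ⟨u, d, e⟩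
      simp only [Finset.mem_filter, mem_T hc1]
      rintro ⟨⟨⟨h1, h2, h3⟩, h5⟩, h4⟩
      exact ⟨⟨⟨h2, h1, by linarith⟩, by omega⟩, by linarith⟩
    · rintro ⟨u, d, e⟩
      simp only [Finset.mem_filter, mem_T hc1]
      rintro ⟨⟨⟨h1, h2, h3⟩, h5⟩, h4⟩
      have h6 : d ≠ e + 2 * u := by
        intro h
        have h6 : (e + u) ^ 2 = N := by rw [← h3, h]; ring
        have := sq_mod8 (e + u)
        omega
      exact ⟨⟨⟨h2, h1, by linarith⟩, by omega⟩, by omega⟩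
    · rintro ⟨u, d, e⟩ _; simp
    · rintro ⟨u, d, e⟩ _; simp
    · rintro ⟨u, d, e⟩
      simp only [Finset.mem_filter, mem_T hc1]
      rintro ⟨⟨⟨h1, h2, h3⟩, h5⟩, h4⟩
      obtain ⟨a1, a2, a3⟩ := L1_aux2 hN h3 h5
      rw [chi_anti a3]; ring
  have h4 : ∑ p ∈ (T 1 N).filter (fun p => p.1 % 2 = 0), (p.2.1 + p.2.2) * p.1 * chi p.2.1 = 0 := by
    have : ∑ p ∈ (T 1 N).filter (fun p => p.1 % 2 = 0), (p.2.1 + p.2.2) * p.1 * chi p.2.1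
       = ∑ p ∈ (T 1 N).filter (fun p => p.1 % 2 = 0), -((p.2.1 + p.2.2) * p.1 * chi p.2.1) := by
      refine Finset.sum_nbij' (fun p => (-p.1, p.2.1, p.2.2))
        (fun p => (-p.1, p.2.1, p.2.2)) ?_ ?_ ?_ ?_ ?_
      · rintro ⟨u, d, e⟩
        simp only [Finset.mem_filter, mem_T hc1]
        rintro ⟨⟨h1, h2, h3⟩, h4⟩
        exact ⟨⟨h1, h2, by linarith⟩, by omega⟩
      · rintro ⟨u, d, e⟩
        simp only [Finset.mem_filter, mem_T hc1]
        rintro ⟨⟨h1, h2, h3⟩, h4⟩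
        exact ⟨⟨h1, h2, by linarith⟩, by omega⟩
      · rintro ⟨u, d, e⟩ _; simp
      · rintro ⟨u, d, e⟩ _; simp
      · rintro ⟨u, d, e⟩ _; simp
    rw [Finset.sum_neg_distrib] at this
    linarith
  have e1 := Finset.sum_filter_add_sum_filter_not (T 2 N) (fun p => 2 * p.2.2 < p.2.1 + 2 * p.1) (fun p => 2 * (p.2.2 - p.1) * (p.2.1 + p.1) * chi p.2.1)
  have e2 := Finset.sum_filter_add_sum_filter_not ((T 1 N).filter (fun p => p.1 % 2 = 0)) (fun p => p.2.1 < p.2.2 + 2 * p.1) (fun p => (p.2.1 + p.2.2) * p.1 * chi p.2.1)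
  linarith

lemma L1 {N : ℤ} (hN : N % 8 = 3) :
    ∑ p ∈ T 2 N, (N - 3 * p.1 ^ 2) * chi p.2.1 = 0 := by
  have hc : (0 : ℤ) < 2 := by norm_num
  have h := L1_core hN
  have a1 := T_neg hc N (fun u d e => 2 * (u * (e - d) * chi d))
  have a1' : ∑ p ∈ T 2 N, 2 * (-p.1 * (p.2.2 - p.2.1) * chi p.2.1)
      = -∑ p ∈ T 2 N, 2 * (p.1 * (p.2.2 - p.2.1) * chi p.2.1) := by
    rw [← Finset.sum_neg_distrib]; exact Finset.sum_congr rfl fun p _ => by ring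
  have b3 : ∑ p ∈ T 2 N, (N - 3 * p.1 ^ 2) * chi p.2.1 =
     ∑ p ∈ T 2 N, 2 * (p.2.2 - p.1) * (p.2.1 + p.1) * chi p.2.1
      - ∑ p ∈ T 2 N, 2 * (p.1 * (p.2.2 - p.2.1) * chi p.2.1) := by
    simp only [← Finset.sum_sub_distrib]
    refine Finset.sum_congr rfl ?_
    rintro ⟨u, d, e⟩ hp
    rw [mem_T hc] at hp
    simp only
    rw [← hp.2.2]; ring
  linarith

/-! ### the identity for `u^2 + 8 d e` -/

lemma odd_of_sq {M u : ℤ} {k : ℤ} (hM : M % 2 = 1) (h : u ^ 2 + 8 * k = M) : u % 2 = 1 := by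
  by_contra h5
  have := sq_even_mod4 (x := u) (by omega)
  omega

lemma L8_half {M : ℤ} (hM : M % 2 = 1) :
    ∑ p ∈ T 8 M, sg p.2.2 * chi p.2.1
      = 2 * ∑ p ∈ (T 8 M).filter (fun p => (p.2.1 - p.1) % 4 = 2), sg p.2.2 * chi p.2.1 := by
  have hc : (0 : ℤ) < 8 := by norm_num
  have h1 : ∑ p ∈ (T 8 M).filter (fun p => (p.2.1 - p.1) % 4 = 2), sg p.2.2 * chi p.2.1
     = ∑ p ∈ ((T 8 M).filter (fun p => ¬ (p.2.1 - p.1) % 4 = 2)).filter (fun p => p.2.1 % 2 = 1), sg p.2.2 * chi p.2.1 := by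
    refine Finset.sum_nbij' (fun p => (-p.1, p.2.1, p.2.2))
        (fun p => (-p.1, p.2.1, p.2.2)) ?_ ?_ ?_ ?_ ?_
    · rintro ⟨u, d, e⟩
      simp only [Finset.mem_filter, mem_T hc]
      rintro ⟨⟨h1, h2, h3⟩, h4⟩
      have := odd_of_sq hM h3
      exact ⟨⟨⟨h1, h2, by linarith⟩, by omega⟩, by omega⟩
    · rintro ⟨u, d, e⟩
      simp only [Finset.mem_filter, mem_T hc]
      rintro ⟨⟨⟨h1, h2, h3⟩, h4⟩, h5⟩
      have := odd_of_sq hM h3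
      exact ⟨⟨h1, h2, by linarith⟩, by omega⟩
    · rintro ⟨u, d, e⟩ _; simp
    · rintro ⟨u, d, e⟩ _; simp
    · rintro ⟨u, d, e⟩ _; simp
  have h2 : ∑ p ∈ ((T 8 M).filter (fun p => ¬ (p.2.1 - p.1) % 4 = 2)).filter (fun p => ¬ p.2.1 % 2 = 1), sg p.2.2 * chi p.2.1 = 0 := by
    apply Finset.sum_eq_zero
    intro p hp
    rw [Finset.mem_filter] at hp
    rw [chi_even hp.2, mul_zero]
  rw [← Finset.sum_filter_add_sum_filter_not (T 8 M) (fun p => (p.2.1 - p.1) % 4 = 2),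
    ← Finset.sum_filter_add_sum_filter_not ((T 8 M).filter (fun p => ¬ (p.2.1 - p.1) % 4 = 2)) (fun p => p.2.1 % 2 = 1)]
  linarith

lemma L8_bd {M : ℤ} (hM : M % 2 = 1) :
    ∑ p ∈ T 8 M, sg p.2.2 * chi p.2.1
      = 2 * ∑ p ∈ (T 8 M).filter (fun p => (p.2.1 - p.1) % 4 = 2 ∧ 2 * p.2.2 + p.1 - p.2.1 = 0), sg p.2.2 * chi p.2.1 := by
  have hc : (0 : ℤ) < 8 := by norm_num
  have hc1 : (0 : ℤ) < 16 := by norm_num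
  rw [L8_half hM]
  congr 1
  have h1 : ∑ p ∈ ((T 8 M).filter (fun p => (p.2.1 - p.1) % 4 = 2)).filter (fun p => 0 < 2 * p.2.2 + p.1 - p.2.1), sg p.2.2 * chi p.2.1 = 0 := by
    have : ∑ p ∈ ((T 8 M).filter (fun p => (p.2.1 - p.1) % 4 = 2)).filter (fun p => 0 < 2 * p.2.2 + p.1 - p.2.1), sg p.2.2 * chi p.2.1 =
      ∑ p ∈ ((T 8 M).filter (fun p => (p.2.1 - p.1) % 4 = 2)).filter (fun p => 0 < 2 * p.2.2 + p.1 - p.2.1), -(sg p.2.2 * chi p.2.1) := by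
      refine Finset.sum_nbij' (fun p => (2 * p.2.1 - p.1, p.2.1, p.2.2 + (p.1 - p.2.1) / 2))
        (fun p => (2 * p.2.1 - p.1, p.2.1, p.2.2 + (p.1 - p.2.1) / 2)) ?_ ?_ ?_ ?_ ?_
      · rintro ⟨u, d, e⟩
        simp only [Finset.mem_filter, mem_T hc]
        rintro ⟨⟨⟨h1, h2, h3⟩, h4⟩, h5⟩
        obtain ⟨k, hk⟩ : ∃ k, u - d = 2 * k := ⟨(u - d) / 2, by omega⟩
        rw [hk, Int.mul_ediv_cancel_left _ (by norm_num)]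
        have : u = 2 * k + d := by linarith
        subst this
        exact ⟨⟨⟨h1, by linarith, by linarith⟩, by omega⟩, by linarith⟩
      · rintro ⟨u, d, e⟩
        simp only [Finset.mem_filter, mem_T hc]
        rintro ⟨⟨⟨h1, h2, h3⟩, h4⟩, h5⟩
        obtain ⟨k, hk⟩ : ∃ k, u - d = 2 * k := ⟨(u - d) / 2, by omega⟩
        rw [hk, Int.mul_ediv_cancel_left _ (by norm_num)]
        have : u = 2 * k + d := by linarith
        subst this
        exact ⟨⟨⟨h1, by linarith, by linarith⟩, by omega⟩, by linarith⟩
      · rintro ⟨u, d, e⟩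
        simp only [Finset.mem_filter, mem_T hc]
        rintro ⟨⟨⟨h1, h2, h3⟩, h4⟩, h5⟩
        simp only [Prod.mk.injEq, true_and]; constructor <;> omega
      · rintro ⟨u, d, e⟩
        simp only [Finset.mem_filter, mem_T hc]
        rintro ⟨⟨⟨h1, h2, h3⟩, h4⟩, h5⟩
        simp only [Prod.mk.injEq, true_and]; constructor <;> omega
      · rintro ⟨u, d, e⟩
        simp only [Finset.mem_filter, mem_T hc]
        rintro ⟨⟨⟨h1, h2, h3⟩, h4⟩, h5⟩
        rw [sg_anti (a := e) (b := e + (u - d) / 2) (by omega)]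
        ring
    rw [Finset.sum_neg_distrib] at this
    linarith
  have h2 : ∑ p ∈ ((T 8 M).filter (fun p => (p.2.1 - p.1) % 4 = 2)).filter (fun p => 2 * p.2.2 + p.1 - p.2.1 < 0), sg p.2.2 * chi p.2.1
     = ∑ p ∈ ((T 16 M).filter (fun p => (p.2.1 + p.2.2) % 2 = 1)).filter (fun p => 0 < p.1 + 2 * p.2.2 - 2 * p.2.1), -(sg p.2.1 * chi p.1) := by
    refine Finset.sum_nbij' (fun p => (p.1 + 4 * p.2.2, p.2.2, (p.2.1 - p.1) / 2 - p.2.2))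
        (fun p => (p.1 - 4 * p.2.1, p.1 + 2 * p.2.2 - 2 * p.2.1, p.2.1)) ?_ ?_ ?_ ?_ ?_
    · rintro ⟨u, d, e⟩
      simp only [Finset.mem_filter, mem_T hc, mem_T hc1]
      rintro ⟨⟨⟨h1, h2, h3⟩, h4⟩, h5⟩
      obtain ⟨k, hk⟩ : ∃ k, d - u = 2 * k := ⟨(d - u) / 2, by omega⟩
      rw [hk, Int.mul_ediv_cancel_left _ (by norm_num)]
      have : d = 2 * k + u := by linarith
      subst this
      exact ⟨⟨⟨h2, by linarith, by linarith⟩, by omega⟩, by linarith⟩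
    · rintro ⟨u, d, e⟩
      simp only [Finset.mem_filter, mem_T hc, mem_T hc1]
      rintro ⟨⟨⟨h1, h2, h3⟩, h4⟩, h5⟩
      exact ⟨⟨⟨h5, h1, by linarith⟩, by omega⟩, by linarith⟩
    · rintro ⟨u, d, e⟩
      simp only [Finset.mem_filter, mem_T hc, mem_T hc1]
      rintro ⟨⟨⟨h1, h2, h3⟩, h4⟩, h5⟩
      simp only [Prod.mk.injEq, and_true]; constructor <;> omega
    · rintro ⟨u, d, e⟩
      simp only [Finset.mem_filter, mem_T hc, mem_T hc1]
      rintro ⟨⟨⟨h1, h2, h3⟩, h4⟩, h5⟩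
      simp only [Prod.mk.injEq, true_and]; constructor <;> omega
    · rintro ⟨u, d, e⟩
      simp only [Finset.mem_filter, mem_T hc, mem_T hc1]
      rintro ⟨⟨⟨h1, h2, h3⟩, h4⟩, h5⟩
      have := odd_of_sq hM h3
      rw [chi_anti2 (a := d) (b := u + 4 * e) (by omega) (by omega)]
      ring
  have h3 : ∑ p ∈ ((T 16 M).filter (fun p => (p.2.1 + p.2.2) % 2 = 1)).filter (fun p => 0 < p.1 + 2 * p.2.2 - 2 * p.2.1), -(sg p.2.1 * chi p.1)
     = ∑ p ∈ ((T 16 M).filter (fun p => (p.2.1 + p.2.2) % 2 = 1)).filter (fun p => ¬ 0 < p.1 + 2 * p.2.2 - 2 * p.2.1), -(sg p.2.1 * chi p.1) := by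
    refine Finset.sum_nbij' (fun p => (-p.1, p.2.2, p.2.1))
        (fun p => (-p.1, p.2.2, p.2.1)) ?_ ?_ ?_ ?_ ?_
    · rintro ⟨u, d, e⟩
      simp only [Finset.mem_filter, mem_T hc1]
      rintro ⟨⟨⟨h1, h2, h3⟩, h5⟩, h4⟩
      exact ⟨⟨⟨h2, h1, by linarith⟩, by omega⟩, by linarith⟩
    · rintro ⟨u, d, e⟩
      simp only [Finset.mem_filter, mem_T hc1]
      rintro ⟨⟨⟨h1, h2, h3⟩, h5⟩, h4⟩
      have := odd_of_sq (u := u) (k := 2 * (d * e)) hM (by linarith)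
      exact ⟨⟨⟨h2, h1, by linarith⟩, by omega⟩, by omega⟩
    · rintro ⟨u, d, e⟩ _; simp
    · rintro ⟨u, d, e⟩ _; simp
    · rintro ⟨u, d, e⟩
      simp only [Finset.mem_filter, mem_T hc1]
      rintro ⟨⟨⟨h1, h2, h3⟩, h5⟩, h4⟩
      rw [chi_anti (a := u) (b := -u) (by omega), sg_anti (a := d) (b := e) (by omega)]; ring
  have h4 : ∑ p ∈ ((T 16 M).filter (fun p => (p.2.1 + p.2.2) % 2 = 1)), -(sg p.2.1 * chi p.1) = 0 := by
    have : ∑ p ∈ ((T 16 M).filter (fun p => (p.2.1 + p.2.2) % 2 = 1)), -(sg p.2.1 * chi p.1)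
      = ∑ p ∈ ((T 16 M).filter (fun p => (p.2.1 + p.2.2) % 2 = 1)), -(-(sg p.2.1 * chi p.1)) := by
      refine Finset.sum_nbij' (fun p => (-p.1, p.2.1, p.2.2))
        (fun p => (-p.1, p.2.1, p.2.2)) ?_ ?_ ?_ ?_ ?_
      · rintro ⟨u, d, e⟩
        simp only [Finset.mem_filter, mem_T hc1]
        rintro ⟨⟨h1, h2, h3⟩, h4⟩
        exact ⟨⟨h1, h2, by linarith⟩, by omega⟩
      · rintro ⟨u, d, e⟩
        simp only [Finset.mem_filter, mem_T hc1]
        rintro ⟨⟨h1, h2, h3⟩, h4⟩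
        exact ⟨⟨h1, h2, by linarith⟩, by omega⟩
      · rintro ⟨u, d, e⟩ _; simp
      · rintro ⟨u, d, e⟩ _; simp
      · rintro ⟨u, d, e⟩ _
        simp only
        rw [chi_anti (a := u) (b := -u) (by omega)]; ring
    simp only [Finset.sum_neg_distrib, neg_neg] at this ⊢
    linarith
  have e1 := Finset.sum_filter_add_sum_filter_not ((T 8 M).filter (fun p => (p.2.1 - p.1) % 4 = 2)) (fun p => 0 < 2 * p.2.2 + p.1 - p.2.1) (fun p => sg p.2.2 * chi p.2.1)
  have e3 := Finset.sum_filter_add_sum_filter_not (((T 8 M).filter (fun p => (p.2.1 - p.1) % 4 = 2)).filter (fun p => ¬ 0 < 2 * p.2.2 + p.1 - p.2.1)) (fun p => 2 * p.2.2 + p.1 - p.2.1 < 0) (fun p => sg p.2.2 * chi p.2.1)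
  have e2 := Finset.sum_filter_add_sum_filter_not ((T 16 M).filter (fun p => (p.2.1 + p.2.2) % 2 = 1)) (fun p => 0 < p.1 + 2 * p.2.2 - 2 * p.2.1) (fun p => -(sg p.2.1 * chi p.1))
  have s1 : (((T 8 M).filter (fun p => (p.2.1 - p.1) % 4 = 2)).filter (fun p => ¬ 0 < 2 * p.2.2 + p.1 - p.2.1)).filter (fun p => 2 * p.2.2 + p.1 - p.2.1 < 0)
     = ((T 8 M).filter (fun p => (p.2.1 - p.1) % 4 = 2)).filter (fun p => 2 * p.2.2 + p.1 - p.2.1 < 0) := by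
    ext p; simp only [Finset.mem_filter]; constructor
    · rintro ⟨⟨h1, h2⟩, h3⟩; exact ⟨h1, h3⟩
    · rintro ⟨h1, h3⟩; exact ⟨⟨h1, by omega⟩, h3⟩
  have s2 : (((T 8 M).filter (fun p => (p.2.1 - p.1) % 4 = 2)).filter (fun p => ¬ 0 < 2 * p.2.2 + p.1 - p.2.1)).filter (fun p => ¬ 2 * p.2.2 + p.1 - p.2.1 < 0)
     = (T 8 M).filter (fun p => (p.2.1 - p.1) % 4 = 2 ∧ 2 * p.2.2 + p.1 - p.2.1 = 0) := by
    ext p; simp only [Finset.mem_filter]; constructor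
    · rintro ⟨⟨⟨h0, h1⟩, h2⟩, h3⟩; exact ⟨h0, h1, by omega⟩
    · rintro ⟨h0, h1, h3⟩; exact ⟨⟨⟨h0, h1⟩, by omega⟩, by omega⟩
  rw [s1, s2] at e3
  linarith

lemma L8_nonsq {M : ℤ} (hM : M % 2 = 1) (h : ∀ x : ℤ, x ^ 2 ≠ M) :
    ∑ p ∈ T 8 M, sg p.2.2 * chi p.2.1 = 0 := by
  have hc : (0 : ℤ) < 8 := by norm_num
  rw [L8_bd hM, Finset.sum_eq_zero, mul_zero]
  rintro ⟨u, d, e⟩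
  simp only [Finset.mem_filter, mem_T hc]
  rintro ⟨⟨h1, h2, h3⟩, h4, h5⟩
  exfalso
  have : u = d - 2 * e := by linarith
  subst this
  exact h (d + 2 * e) (by linarith)

lemma L8_sq {X : ℤ} (hX : X % 2 = 1) (h0 : 0 < X) :
    2 * ∑ p ∈ T 8 (X ^ 2), sg p.2.2 * chi p.2.1 = chi X * X - 1 := by
  have hc : (0 : ℤ) < 8 := by norm_num
  have hM : X ^ 2 % 2 = 1 := by have := sq_odd_mod8 hX; omega
  rw [L8_bd hM]
  have h1 : ∑ p ∈ (T 8 (X ^ 2)).filter (fun p => (p.2.1 - p.1) % 4 = 2 ∧ 2 * p.2.2 + p.1 - p.2.1 = 0), sg p.2.2 * chi p.2.1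
     = ∑ j ∈ Finset.Ico (0 : ℤ) ((X + 1) / 4), chi X := by
    refine Finset.sum_nbij' (fun p => (p.2.2 - 1) / 2)
        (fun j => (X - 4 * (2 * j + 1), X - 2 * (2 * j + 1), 2 * j + 1)) ?_ ?_ ?_ ?_ ?_
    · rintro ⟨u, d, e⟩
      simp only [Finset.mem_filter, mem_T hc, Finset.mem_Ico]
      rintro ⟨⟨h1, h2, h3⟩, h4, h5⟩
      have : u = d - 2 * e := by linarith
      subst this
      have h6 : X = d + 2 * e := by
        have : (X - (d + 2 * e)) * (X + (d + 2 * e)) = 0 := by linarith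
        rcases mul_eq_zero.1 this with h | h <;> linarith
      omega
    · intro j
      simp only [Finset.mem_filter, mem_T hc, Finset.mem_Ico]
      rintro ⟨h1, h2⟩
      exact ⟨⟨by omega, by omega, by ring⟩, by omega, by omega⟩
    · rintro ⟨u, d, e⟩
      simp only [Finset.mem_filter, mem_T hc]
      rintro ⟨⟨h1, h2, h3⟩, h4, h5⟩
      have : u = d - 2 * e := by linarith
      subst this
      have h6 : X = d + 2 * e := by
        have : (X - (d + 2 * e)) * (X + (d + 2 * e)) = 0 := by linarith
        rcases mul_eq_zero.1 this with h | h <;> linarith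
      simp only [Prod.mk.injEq]
      refine ⟨?_, ?_, ?_⟩ <;> omega
    · intro j _; simp
    · rintro ⟨u, d, e⟩
      simp only [Finset.mem_filter, mem_T hc]
      rintro ⟨⟨h1, h2, h3⟩, h4, h5⟩
      have : u = d - 2 * e := by linarith
      subst this
      have h6 : X = d + 2 * e := by
        have : (X - (d + 2 * e)) * (X + (d + 2 * e)) = 0 := by linarith
        rcases mul_eq_zero.1 this with h | h <;> linarith
      rw [chi_anti2 (a := X) (b := d) hX (by omega)]
      unfold sg
      rw [if_neg (by omega)]; ring
  rw [h1]
  simp only [Finset.sum_const, Int.card_Ico, nsmul_eq_mul]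
  rw [sub_zero, Int.toNat_of_nonneg (by omega)]
  unfold chi
  split_ifs <;> omega


lemma uniq (c : ℤ) (hc : 0 < c) (r : ℤ → Prop) [DecidablePred r] (hr1 : r 1)
    (hr : ∀ u, r u → u % 2 = 1) (D : ℤ → ℤ) (hD : D c = 0)
    (hrec : ∀ N, N % 8 = (c + 1) % 8 → ∑ u ∈ (bx N).filter r, (N - (c + 1) * u ^ 2) * D (N - u ^ 2) = 0)
    (hneg : ∀ K, K ≤ 0 → D K = 0) :
    ∀ K, K % 8 = c % 8 → D K = 0 := by
  have key : ∀ n : ℕ, ∀ K : ℤ, K < n → K % 8 = c % 8 → D K = 0 := by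
    intro n
    induction n with
    | zero => intro K hK _; exact hneg K (by push_cast at hK; omega)
    | succ n ih =>
      intro K hK hK8
      by_cases hK0 : K ≤ 0
      · exact hneg K hK0
      by_cases hKc : K = c
      · rw [hKc, hD]
      have h := hrec (K + 1) (by omega)
      have h2 : ∑ u ∈ (bx (K + 1)).filter r, (K + 1 - (c + 1) * u ^ 2) * D (K + 1 - u ^ 2)
        = ∑ u ∈ (bx (K + 1)).filter r, (if u ^ 2 = 1 then (K - c) * D K else 0) := by
        refine Finset.sum_congr rfl ?_
        intro u hu
        rw [Finset.mem_filter] at hu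
        have h8 := sq_odd_mod8 (hr u hu.2)
        split_ifs with h1
        · rw [h1]; congr 1
          · ring
          · congr 1; ring
        · have : D (K + 1 - u ^ 2) = 0 := by
            have : 0 ≤ u ^ 2 := sq_nonneg u
            apply ih
            · push_cast at hK; omega
            · omega
          rw [this, mul_zero]
      rw [h2, ← Finset.sum_filter, Finset.sum_const, nsmul_eq_mul] at h
      have hne : (Finset.card (((bx (K + 1)).filter r).filter (fun u => u ^ 2 = 1)) : ℤ) ≠ 0 := by
        have : 0 < Finset.card (((bx (K + 1)).filter r).filter (fun u => u ^ 2 = 1)) := by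
          apply Finset.card_pos.2
          refine ⟨1, ?_⟩
          simp only [Finset.mem_filter]
          exact ⟨⟨mem_bx_of_sq (by linarith), hr1⟩, by norm_num⟩
        omega
      have hne2 : K - c ≠ 0 := sub_ne_zero.2 hKc
      exact (mul_eq_zero.1 ((mul_eq_zero.1 h).resolve_left hne)).resolve_left hne2
  intro K hK
  exact key (K.toNat + 1) K (by push_cast; have := Int.self_le_toNat K; omega) hK

/-! ### two squares -/

noncomputable def Q2 (K : ℤ) : Finset (ℤ × ℤ) :=
  (bx K ×ˢ bx K).filter (fun p => p.1 ^ 2 + p.2 ^ 2 = K)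

lemma mem_Q2 {K x y : ℤ} : (x, y) ∈ Q2 K ↔ x ^ 2 + y ^ 2 = K := by
  unfold Q2
  simp only [Finset.mem_filter, Finset.mem_product]
  refine ⟨fun h => h.2, fun h => ⟨⟨mem_bx_of_sq ?_, mem_bx_of_sq ?_⟩, h⟩⟩ <;>
    nlinarith [sq_nonneg x, sq_nonneg y]

noncomputable def Q3 (K : ℤ) : Finset (ℤ × ℤ × ℤ) :=
  (bx K ×ˢ bx K ×ˢ bx K).filter (fun p => p.1 ^ 2 + (p.2.1 ^ 2 + p.2.2 ^ 2) = K)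

lemma mem_Q3 {K x y z : ℤ} : (x, y, z) ∈ Q3 K ↔ x ^ 2 + (y ^ 2 + z ^ 2) = K := by
  unfold Q3
  simp only [Finset.mem_filter, Finset.mem_product]
  refine ⟨fun h => h.2, fun h => ⟨⟨mem_bx_of_sq ?_, mem_bx_of_sq ?_, mem_bx_of_sq ?_⟩, h⟩⟩ <;>
    nlinarith [sq_nonneg x, sq_nonneg y, sq_nonneg z]

lemma three_sq_odd {N x y z : ℤ} (hN : N % 8 = 3) (h : x ^ 2 + (y ^ 2 + z ^ 2) = N) : x % 2 = 1 := by
  by_contra hx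
  have h1 := sq_even_mod4 (x := x) (by omega)
  have h2 := sq_mod8 y
  have h3 := sq_mod8 z
  omega

lemma Q3_sum {N : ℤ} (hN : N % 8 = 3) :
    ∑ u ∈ (bx N).filter (fun u => u % 2 = 1), (N - 3 * u ^ 2) * (Finset.card (Q2 (N - u ^ 2)) : ℤ) = 0 := by
  have h1 : ∑ p ∈ Q3 N, (N - 3 * p.1 ^ 2) = ∑ u ∈ (bx N).filter (fun u => u % 2 = 1), ∑ q ∈ Q2 (N - u ^ 2), (N - 3 * u ^ 2) := by
    refine Finset.sum_finset_product (Q3 N) _ _ ?_ (f := fun p => (N - 3 * p.1 ^ 2))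
    rintro ⟨u, x, y⟩
    simp only [Finset.mem_filter, mem_Q3, mem_Q2]
    constructor
    · intro h
      exact ⟨⟨mem_bx_of_sq (by nlinarith [sq_nonneg x, sq_nonneg y]), three_sq_odd hN h⟩, by linarith⟩
    · rintro ⟨-, h⟩; linarith
  have h2 : ∑ p ∈ Q3 N, p.1 ^ 2 = ∑ p ∈ Q3 N, p.2.1 ^ 2 := by
    refine Finset.sum_nbij' (fun p => (p.2.1, p.1, p.2.2)) (fun p => (p.2.1, p.1, p.2.2)) ?_ ?_ ?_ ?_ ?_
    · rintro ⟨u, x, y⟩; simp only [mem_Q3]; intro h; linarith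
    · rintro ⟨u, x, y⟩; simp only [mem_Q3]; intro h; linarith
    · rintro ⟨u, x, y⟩ _; simp
    · rintro ⟨u, x, y⟩ _; simp
    · rintro ⟨u, x, y⟩ _; simp
  have h3 : ∑ p ∈ Q3 N, p.1 ^ 2 = ∑ p ∈ Q3 N, p.2.2 ^ 2 := by
    refine Finset.sum_nbij' (fun p => (p.2.2, p.2.1, p.1)) (fun p => (p.2.2, p.2.1, p.1)) ?_ ?_ ?_ ?_ ?_
    · rintro ⟨u, x, y⟩; simp only [mem_Q3]; intro h; linarith
    · rintro ⟨u, x, y⟩; simp only [mem_Q3]; intro h; linarith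
    · rintro ⟨u, x, y⟩ _; simp
    · rintro ⟨u, x, y⟩ _; simp
    · rintro ⟨u, x, y⟩ _; simp
  have h4 : ∑ p ∈ Q3 N, (N - 3 * p.1 ^ 2) = ∑ p ∈ Q3 N, p.2.1 ^ 2 + ∑ p ∈ Q3 N, p.2.2 ^ 2 - 2 * ∑ p ∈ Q3 N, p.1 ^ 2 := by
    simp only [Finset.mul_sum, ← Finset.sum_sub_distrib, ← Finset.sum_add_distrib]
    refine Finset.sum_congr rfl ?_
    rintro ⟨u, x, y⟩ h
    rw [mem_Q3] at h
    simp only; linarith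
  rw [h1] at h4
  simp only [Finset.sum_const, nsmul_eq_mul] at h4
  calc _ = _ := Finset.sum_congr rfl fun u _ => mul_comm _ _
    _ = _ := h4
    _ = 0 := by linarith

lemma Pr_empty {c K : ℤ} (hc : 0 < c) (hK : K ≤ 0) : Pr c K = ∅ := by
  rw [Finset.eq_empty_iff_forall_notMem]
  rintro ⟨d, e⟩ h
  rw [mem_Pr hc] at h
  obtain ⟨h1, h2, h3⟩ := h
  have : 0 < c * (d * e) := by positivity
  linarith

lemma Q2_neg {K : ℤ} (hK : K < 0) : Q2 K = ∅ := by
  rw [Finset.eq_empty_iff_forall_notMem]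
  rintro ⟨d, e⟩ h
  rw [mem_Q2] at h
  nlinarith [sq_nonneg d, sq_nonneg e]

lemma Pr_self {c : ℤ} (hc : 0 < c) : Pr c c = {(1, 1)} := by
  ext ⟨d, e⟩
  rw [mem_Pr hc]
  simp only [Finset.mem_singleton, Prod.mk.injEq]
  constructor
  · rintro ⟨h1, h2, h3⟩
    have h4 : d * e = 1 := by
      have : c * (d * e - 1) = 0 := by linarith
      rcases mul_eq_zero.1 this with h | h <;> linarith
    constructor <;> nlinarith
  · rintro ⟨rfl, rfl⟩; simp

lemma Q2_two : Finset.card (Q2 2) = 4 := by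
  have : Q2 2 = {(1, 1), (1, -1), (-1, 1), (-1, -1)} := by
    ext ⟨x, y⟩
    rw [mem_Q2]
    simp only [Finset.mem_insert, Finset.mem_singleton, Prod.mk.injEq]
    constructor
    · intro h
      have h1 : -1 ≤ x := by nlinarith [sq_nonneg y]
      have h2 : x ≤ 1 := by nlinarith [sq_nonneg y]
      have h3 : -1 ≤ y := by nlinarith [sq_nonneg x]
      have h4 : y ≤ 1 := by nlinarith [sq_nonneg x]
      interval_cases x <;> interval_cases y <;> simp_all
    · rintro (⟨rfl, rfl⟩ | ⟨rfl, rfl⟩ | ⟨rfl, rfl⟩ | ⟨rfl, rfl⟩) <;> norm_num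
  rw [this]; rfl

lemma r2_two {K : ℤ} (hK : K % 8 = 2) :
    (Finset.card (Q2 K) : ℤ) = 4 * ∑ q ∈ Pr 2 K, chi q.1 := by
  have hc : (0 : ℤ) < 2 := by norm_num
  have := uniq 2 hc (fun u => u % 2 = 1) (by norm_num) (fun u h => h)
    (fun K => if K ≤ 0 then 0 else (Finset.card (Q2 K) : ℤ) - 4 * ∑ q ∈ Pr 2 K, chi q.1) ?_ ?_ ?_ K (by omega)
  · by_cases h0 : K ≤ 0
    · rw [Pr_empty hc h0, Q2_neg (by omega)]; simp
    · rw [if_neg h0] at this; linarith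
  · rw [if_neg (by norm_num), Pr_self hc, Q2_two]; simp [chi]
  · intro N hN
    have hN : N % 8 = 3 := by omega
    have h1 := Q3_sum hN
    have h2 := L1 hN
    have h3 : ∑ p ∈ T 2 N, (N - 3 * p.1 ^ 2) * chi p.2.1 = ∑ p ∈ (T 2 N).filter (fun p => p.1 % 2 = 1), (N - 3 * p.1 ^ 2) * chi p.2.1 := by
      rw [Finset.filter_true_of_mem]
      rintro ⟨u, d, e⟩ h
      rw [mem_T hc] at h
      exact (L1_aux hN h.2.2).1
    rw [h3, sum_T_filter hc N (fun u => u % 2 = 1)] at h2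
    have h4 : ∀ u ∈ (bx N).filter (fun u => u % 2 = 1),
      (N - (2 + 1) * u ^ 2) * (if N - u ^ 2 ≤ 0 then 0 else (Finset.card (Q2 (N - u ^ 2)) : ℤ) - 4 * ∑ q ∈ Pr 2 (N - u ^ 2), chi q.1)
       = (N - 3 * u ^ 2) * (Finset.card (Q2 (N - u ^ 2)) : ℤ) - 4 * ∑ q ∈ Pr 2 (N - u ^ 2), (N - 3 * u ^ 2) * chi q.1 := by
      intro u hu
      rw [Finset.mem_filter] at hu
      rw [← Finset.mul_sum]
      split_ifs with h
      · have := sq_odd_mod8 hu.2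
        rw [Pr_empty hc h, Q2_neg (by omega)]; simp
      · ring
    rw [Finset.sum_congr rfl h4, Finset.sum_sub_distrib, ← Finset.mul_sum, h1, h2]; simp
  · intro K hK; rw [if_pos hK]

lemma Q2_double (K : ℤ) : Finset.card (Q2 (2 * K)) = Finset.card (Q2 K) := by
  symm
  refine Finset.card_nbij' (fun p => (p.1 + p.2, p.1 - p.2)) (fun p => ((p.1 + p.2) / 2, (p.1 - p.2) / 2)) ?_ ?_ ?_ ?_
  · rintro ⟨x, y⟩; simp only [Finset.mem_coe, mem_Q2]; intro h; linarith
  · rintro ⟨x, y⟩; simp only [Finset.mem_coe, mem_Q2]; intro h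
    obtain ⟨a, ha⟩ : ∃ a, x = y + 2 * a := by
      refine ⟨(x - y) / 2, ?_⟩
      have h1 : (x + y) % 2 = 0 := by
        by_contra hne
        have := sq_odd_mod8 (x := x + y) (by omega)
        have : (x + y) ^ 2 = 2 * (K + x * y) := by linarith
        omega
      omega
    subst ha
    have e1 : (y + 2 * a + y) / 2 = y + a := by omega
    have e2 : (y + 2 * a - y) / 2 = a := by omega
    rw [e1, e2]; linarith
  · rintro ⟨x, y⟩ _; simp only [Prod.mk.injEq]; constructor <;> omega
  · rintro ⟨x, y⟩; simp only [Finset.mem_coe, mem_Q2]; intro h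
    have h1 : (x + y) % 2 = 0 := by
        by_contra hne
        have := sq_odd_mod8 (x := x + y) (by omega)
        have : (x + y) ^ 2 = 2 * (K + x * y) := by linarith
        omega
    simp only [Prod.mk.injEq]; constructor <;> omega

lemma chi_Pr_double (K : ℤ) : ∑ q ∈ Pr 1 (2 * K), chi q.1 = ∑ q ∈ Pr 1 K, chi q.1 := by
  have hc : (0 : ℤ) < 1 := by norm_num
  have h1 : ∀ K : ℤ, ∑ q ∈ Pr 1 K, chi q.1 = ∑ q ∈ (Pr 1 K).filter (fun q => q.1 % 2 = 1), chi q.1 := by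
    intro K
    rw [← Finset.sum_filter_add_sum_filter_not (Pr 1 K) (fun q => q.1 % 2 = 1)]
    rw [Finset.sum_eq_zero (s := (Pr 1 K).filter (fun q => ¬ q.1 % 2 = 1)), add_zero]
    intro q hq
    rw [Finset.mem_filter] at hq
    exact chi_even hq.2
  rw [h1, h1 K]
  symm
  refine Finset.sum_nbij' (fun p => (p.1, 2 * p.2)) (fun p => (p.1, p.2 / 2)) ?_ ?_ ?_ ?_ ?_
  · rintro ⟨d, e⟩
    simp only [Finset.mem_filter, mem_Pr hc]
    rintro ⟨⟨a, b, c⟩, h⟩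
    exact ⟨⟨a, by linarith, by linarith⟩, h⟩
  · rintro ⟨d, e⟩
    simp only [Finset.mem_filter, mem_Pr hc]
    rintro ⟨⟨a, b, c⟩, h⟩
    have he : e % 2 = 0 := by
      have : Even (d * e) := ⟨K, by linarith⟩
      rcases Int.even_mul.1 this with h | h
      · have := Int.even_iff.1 h; omega
      · exact Int.even_iff.1 h
    obtain ⟨k, rfl⟩ : ∃ k, e = 2 * k := ⟨e / 2, by omega⟩
    rw [Int.mul_ediv_cancel_left _ (by norm_num)]
    exact ⟨⟨a, by linarith, by linarith⟩, h⟩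
  · rintro ⟨d, e⟩ _; simp
  · rintro ⟨d, e⟩
    simp only [Finset.mem_filter, mem_Pr hc]
    rintro ⟨⟨a, b, c⟩, h⟩
    have he : e % 2 = 0 := by
      have : Even (d * e) := ⟨K, by linarith⟩
      rcases Int.even_mul.1 this with h | h
      · have := Int.even_iff.1 h; omega
      · exact Int.even_iff.1 h
    simp only [Prod.mk.injEq, true_and]; omega
  · rintro ⟨d, e⟩ _; simp

lemma Pr_scale {c : ℤ} (hc : 0 < c) (K : ℤ) : Pr c (c * K) = Pr 1 K := by
  ext ⟨d, e⟩
  rw [mem_Pr hc, mem_Pr one_pos, one_mul, mul_right_inj' hc.ne']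

lemma r2_formula_nat : ∀ n : ℕ, 0 < n → (Finset.card (Q2 n) : ℤ) = 4 * ∑ q ∈ Pr 1 n, chi q.1 := by
  intro n
  induction n using Nat.strong_induction_on with
  | _ n ih =>
    intro hn
    have hcase : n % 2 = 0 ∨ n % 4 = 1 ∨ n % 4 = 3 := by omega
    rcases hcase with h | h | h
    · obtain ⟨k, rfl⟩ : ∃ k, n = 2 * k := ⟨n / 2, by omega⟩
      push_cast
      rw [Q2_double, chi_Pr_double]
      exact ih k (by omega) (by omega)
    · rw [← Q2_double, r2_two (by omega), Pr_scale (by norm_num)]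
    · have h1 : Q2 (n : ℤ) = ∅ := by
        rw [Finset.eq_empty_iff_forall_notMem]
        rintro ⟨x, y⟩ h
        rw [mem_Q2] at h
        have := sq_mod8 x
        have := sq_mod8 y
        omega
      have h2 : ∑ q ∈ Pr 1 (n : ℤ), chi q.1 = ∑ q ∈ Pr 1 (n : ℤ), - chi q.1 := by
        refine Finset.sum_nbij' (fun p => (p.2, p.1)) (fun p => (p.2, p.1)) ?_ ?_ ?_ ?_ ?_
        · rintro ⟨d, e⟩; simp only [mem_Pr one_pos]; rintro ⟨a, b, c⟩; exact ⟨b, a, by linarith⟩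
        · rintro ⟨d, e⟩; simp only [mem_Pr one_pos]; rintro ⟨a, b, c⟩; exact ⟨b, a, by linarith⟩
        · rintro ⟨d, e⟩ _; simp
        · rintro ⟨d, e⟩ _; simp
        · rintro ⟨d, e⟩; simp only [mem_Pr one_pos]; rintro ⟨a, b, c⟩
          exact chi_anti (mul_mod4_three (by omega)).2.2
      rw [Finset.sum_neg_distrib] at h2
      rw [h1]; simp; linarith

lemma r2_formula {K : ℤ} (hK : 0 < K) : (Finset.card (Q2 K) : ℤ) = 4 * ∑ q ∈ Pr 1 K, chi q.1 := by
  lift K to ℕ using hK.le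
  exact r2_formula_nat K (by omega)


/-! ### four squares -/

noncomputable def Q4 (K : ℤ) : Finset (ℤ × ℤ × ℤ × ℤ) :=
  (bx K ×ˢ bx K ×ˢ bx K ×ˢ bx K).filter (fun p =>
    p.1 % 4 = 1 ∧ p.2.1 % 4 = 1 ∧ p.2.2.1 % 4 = 1 ∧ p.2.2.2 % 4 = 1 ∧
    p.1 ^ 2 + p.2.1 ^ 2 + p.2.2.1 ^ 2 + p.2.2.2 ^ 2 = K)

lemma mem_Q4 {K x y z w : ℤ} : (x, y, z, w) ∈ Q4 K ↔
    x % 4 = 1 ∧ y % 4 = 1 ∧ z % 4 = 1 ∧ w % 4 = 1 ∧ x ^ 2 + y ^ 2 + z ^ 2 + w ^ 2 = K := by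
  unfold Q4
  simp only [Finset.mem_filter, Finset.mem_product]
  refine ⟨fun h => h.2, fun h => ⟨⟨mem_bx_of_sq ?_, mem_bx_of_sq ?_, mem_bx_of_sq ?_, mem_bx_of_sq ?_⟩, h⟩⟩ <;>
    linarith [sq_nonneg x, sq_nonneg y, sq_nonneg z, sq_nonneg w, h.2.2.2.2]

noncomputable def Q5 (K : ℤ) : Finset (ℤ × ℤ × ℤ × ℤ × ℤ) :=
  (bx K ×ˢ bx K ×ˢ bx K ×ˢ bx K ×ˢ bx K).filter (fun p =>
    p.1 % 4 = 1 ∧ p.2.1 % 4 = 1 ∧ p.2.2.1 % 4 = 1 ∧ p.2.2.2.1 % 4 = 1 ∧ p.2.2.2.2 % 4 = 1 ∧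
    p.1 ^ 2 + p.2.1 ^ 2 + p.2.2.1 ^ 2 + p.2.2.2.1 ^ 2 + p.2.2.2.2 ^ 2 = K)

lemma mem_Q5 {K u x y z w : ℤ} : (u, x, y, z, w) ∈ Q5 K ↔
    u % 4 = 1 ∧ x % 4 = 1 ∧ y % 4 = 1 ∧ z % 4 = 1 ∧ w % 4 = 1 ∧
      u ^ 2 + x ^ 2 + y ^ 2 + z ^ 2 + w ^ 2 = K := by
  unfold Q5
  simp only [Finset.mem_filter, Finset.mem_product]
  refine ⟨fun h => h.2, fun h => ⟨⟨mem_bx_of_sq ?_, mem_bx_of_sq ?_, mem_bx_of_sq ?_, mem_bx_of_sq ?_, mem_bx_of_sq ?_⟩, h⟩⟩ <;>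
    linarith [sq_nonneg u, sq_nonneg x, sq_nonneg y, sq_nonneg z, sq_nonneg w, h.2.2.2.2.2]

lemma Q5_sum (N : ℤ) :
    ∑ u ∈ (bx N).filter (fun u => u % 4 = 1), (N - 5 * u ^ 2) * (Finset.card (Q4 (N - u ^ 2)) : ℤ) = 0 := by
  have h1 : ∑ p ∈ Q5 N, (N - 5 * p.1 ^ 2) = ∑ u ∈ (bx N).filter (fun u => u % 4 = 1), ∑ q ∈ Q4 (N - u ^ 2), (N - 5 * u ^ 2) := by
    refine Finset.sum_finset_product (Q5 N) _ _ ?_ (f := fun p => (N - 5 * p.1 ^ 2))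
    rintro ⟨u, x, y, z, w⟩
    simp only [Finset.mem_filter, mem_Q5, mem_Q4]
    constructor
    · rintro ⟨h0, h1, h2, h3, h4, h⟩
      exact ⟨⟨mem_bx_of_sq (by linarith [sq_nonneg x, sq_nonneg y, sq_nonneg z, sq_nonneg w]), h0⟩,
        h1, h2, h3, h4, by linarith⟩
    · rintro ⟨⟨-, h0⟩, h1, h2, h3, h4, h⟩; exact ⟨h0, h1, h2, h3, h4, by linarith⟩
  have h2 : ∑ p ∈ Q5 N, p.1 ^ 2 = ∑ p ∈ Q5 N, p.2.1 ^ 2 := by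
    refine Finset.sum_nbij' (fun p => (p.2.1, p.1, p.2.2)) (fun p => (p.2.1, p.1, p.2.2)) ?_ ?_ ?_ ?_ ?_
    · rintro ⟨u, x, y, z, w⟩; simp only [mem_Q5]; rintro ⟨h0, h1, h2, h3, h4, h⟩
      exact ⟨h1, h0, h2, h3, h4, by linarith⟩
    · rintro ⟨u, x, y, z, w⟩; simp only [mem_Q5]; rintro ⟨h0, h1, h2, h3, h4, h⟩
      exact ⟨h1, h0, h2, h3, h4, by linarith⟩
    · rintro ⟨u, x, y⟩ _; simp
    · rintro ⟨u, x, y⟩ _; simp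
    · rintro ⟨u, x, y⟩ _; simp
  have h3 : ∑ p ∈ Q5 N, p.1 ^ 2 = ∑ p ∈ Q5 N, p.2.2.1 ^ 2 := by
    refine Finset.sum_nbij' (fun p => (p.2.2.1, p.2.1, p.1, p.2.2.2)) (fun p => (p.2.2.1, p.2.1, p.1, p.2.2.2)) ?_ ?_ ?_ ?_ ?_
    · rintro ⟨u, x, y, z, w⟩; simp only [mem_Q5]; rintro ⟨h0, h1, h2, h3, h4, h⟩
      exact ⟨h2, h1, h0, h3, h4, by linarith⟩
    · rintro ⟨u, x, y, z, w⟩; simp only [mem_Q5]; rintro ⟨h0, h1, h2, h3, h4, h⟩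
      exact ⟨h2, h1, h0, h3, h4, by linarith⟩
    · rintro ⟨u, x, y⟩ _; simp
    · rintro ⟨u, x, y⟩ _; simp
    · rintro ⟨u, x, y⟩ _; simp
  have h4 : ∑ p ∈ Q5 N, p.1 ^ 2 = ∑ p ∈ Q5 N, p.2.2.2.1 ^ 2 := by
    refine Finset.sum_nbij' (fun p => (p.2.2.2.1, p.2.1, p.2.2.1, p.1, p.2.2.2.2)) (fun p => (p.2.2.2.1, p.2.1, p.2.2.1, p.1, p.2.2.2.2)) ?_ ?_ ?_ ?_ ?_
    · rintro ⟨u, x, y, z, w⟩; simp only [mem_Q5]; rintro ⟨h0, h1, h2, h3, h4, h⟩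
      exact ⟨h3, h1, h2, h0, h4, by linarith⟩
    · rintro ⟨u, x, y, z, w⟩; simp only [mem_Q5]; rintro ⟨h0, h1, h2, h3, h4, h⟩
      exact ⟨h3, h1, h2, h0, h4, by linarith⟩
    · rintro ⟨u, x, y, z, w⟩ _; simp
    · rintro ⟨u, x, y, z, w⟩ _; simp
    · rintro ⟨u, x, y, z, w⟩ _; simp
  have h5 : ∑ p ∈ Q5 N, p.1 ^ 2 = ∑ p ∈ Q5 N, p.2.2.2.2 ^ 2 := by
    refine Finset.sum_nbij' (fun p => (p.2.2.2.2, p.2.1, p.2.2.1, p.2.2.2.1, p.1)) (fun p => (p.2.2.2.2, p.2.1, p.2.2.1, p.2.2.2.1, p.1)) ?_ ?_ ?_ ?_ ?_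
    · rintro ⟨u, x, y, z, w⟩; simp only [mem_Q5]; rintro ⟨h0, h1, h2, h3, h4, h⟩
      exact ⟨h4, h1, h2, h3, h0, by linarith⟩
    · rintro ⟨u, x, y, z, w⟩; simp only [mem_Q5]; rintro ⟨h0, h1, h2, h3, h4, h⟩
      exact ⟨h4, h1, h2, h3, h0, by linarith⟩
    · rintro ⟨u, x, y, z, w⟩ _; simp
    · rintro ⟨u, x, y, z, w⟩ _; simp
    · rintro ⟨u, x, y, z, w⟩ _; simp
  have h6 : ∑ p ∈ Q5 N, (N - 5 * p.1 ^ 2) = ∑ p ∈ Q5 N, p.2.1 ^ 2 + ∑ p ∈ Q5 N, p.2.2.1 ^ 2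
      + ∑ p ∈ Q5 N, p.2.2.2.1 ^ 2 + ∑ p ∈ Q5 N, p.2.2.2.2 ^ 2 - 4 * ∑ p ∈ Q5 N, p.1 ^ 2 := by
    simp only [Finset.mul_sum, ← Finset.sum_sub_distrib, ← Finset.sum_add_distrib]
    refine Finset.sum_congr rfl ?_
    rintro ⟨u, x, y, z, w⟩ h
    rw [mem_Q5] at h
    simp only; linarith [h.2.2.2.2.2]
  rw [h1] at h6
  simp only [Finset.sum_const, nsmul_eq_mul] at h6
  calc _ = _ := Finset.sum_congr rfl fun u _ => mul_comm _ _
    _ = _ := h6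
    _ = 0 := by linarith

lemma Q4_neg {K : ℤ} (hK : K ≤ 0) : Q4 K = ∅ := by
  rw [Finset.eq_empty_iff_forall_notMem]
  rintro ⟨x, y, z, w⟩ h
  rw [mem_Q4] at h
  have h1 : x ≠ 0 := by rintro rfl; omega
  have h2 : 0 < x ^ 2 := by positivity
  linarith [sq_nonneg y, sq_nonneg z, sq_nonneg w, h.2.2.2.2]

lemma one_of_sq {x : ℤ} (hx : x % 4 = 1) : 1 ≤ x ^ 2 := by
  have h1 : x ≠ 0 := by rintro rfl; omega
  have h2 : 0 < x ^ 2 := by positivity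
  linarith

lemma one_of_sq' {x : ℤ} (hx : x % 4 = 1) (h : x ^ 2 ≤ 1) : x = 1 := by
  have h1 : -1 ≤ x := by nlinarith
  have h2 : x ≤ 1 := by nlinarith
  omega

lemma Q4_four : Finset.card (Q4 4) = 1 := by
  have : Q4 4 = {(1, 1, 1, 1)} := by
    ext ⟨x, y, z, w⟩
    rw [mem_Q4]
    simp only [Finset.mem_singleton, Prod.mk.injEq]
    constructor
    · rintro ⟨h1, h2, h3, h4, h⟩
      have a1 := one_of_sq h1
      have a2 := one_of_sq h2
      have a3 := one_of_sq h3
      have a4 := one_of_sq h4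
      exact ⟨one_of_sq' h1 (by linarith), one_of_sq' h2 (by linarith), one_of_sq' h3 (by linarith), one_of_sq' h4 (by linarith)⟩
    · rintro ⟨rfl, rfl, rfl, rfl⟩; norm_num
  rw [this]; rfl

lemma r4_four {K : ℤ} (hK : K % 8 = 4) :
    (Finset.card (Q4 K) : ℤ) = ∑ q ∈ Pr 4 K, q.1 := by
  have hc : (0 : ℤ) < 4 := by norm_num
  have := uniq 4 hc (fun u => u % 4 = 1) (by norm_num) (fun u h => by omega)
    (fun K => (Finset.card (Q4 K) : ℤ) - ∑ q ∈ Pr 4 K, q.1) ?_ ?_ ?_ K (by omega)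
  · linarith
  · rw [Pr_self hc, Q4_four]; simp
  · intro N hN
    have hN : N % 8 = 5 := by omega
    have h1 := Q5_sum N
    have h2 := L3' hN
    rw [sum_T_filter hc N (fun u => u % 4 = 1)] at h2
    have h4 : ∀ u ∈ (bx N).filter (fun u => u % 4 = 1),
      (N - (4 + 1) * u ^ 2) * ((Finset.card (Q4 (N - u ^ 2)) : ℤ) - ∑ q ∈ Pr 4 (N - u ^ 2), q.1)
       = (N - 5 * u ^ 2) * (Finset.card (Q4 (N - u ^ 2)) : ℤ) - ∑ q ∈ Pr 4 (N - u ^ 2), (N - 5 * u ^ 2) * q.1 := by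
      intro u hu
      rw [← Finset.mul_sum]; ring
    rw [Finset.sum_congr rfl h4, Finset.sum_sub_distrib, h1, h2]; simp
  · intro K hK; rw [Pr_empty hc hK, Q4_neg hK]; simp

/-- (w,u,v,z) with 4w^2+u^2+4v^2+4z^2 = m -/
noncomputable def R4 (m : ℤ) : Finset (ℤ × ℤ × ℤ × ℤ) :=
  (bx m ×ˢ bx m ×ˢ bx m ×ˢ bx m).filter (fun p =>
    4 * p.1 ^ 2 + p.2.1 ^ 2 + 4 * p.2.2.1 ^ 2 + 4 * p.2.2.2 ^ 2 = m)

lemma mem_R4 {m w u v z : ℤ} : (w, u, v, z) ∈ R4 m ↔ 4 * w ^ 2 + u ^ 2 + 4 * v ^ 2 + 4 * z ^ 2 = m := by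
  unfold R4
  simp only [Finset.mem_filter, Finset.mem_product]
  refine ⟨fun h => h.2, fun h => ⟨⟨mem_bx_of_sq ?_, mem_bx_of_sq ?_, mem_bx_of_sq ?_, mem_bx_of_sq ?_⟩, h⟩⟩ <;>
    linarith [sq_nonneg u, sq_nonneg v, sq_nonneg z, sq_nonneg w]

lemma R4_odd {m w u v z : ℤ} (hm : m % 4 = 1) (h : 4 * w ^ 2 + u ^ 2 + 4 * v ^ 2 + 4 * z ^ 2 = m) : u % 2 = 1 := by
  by_contra h5
  have := sq_even_mod4 (x := u) (by omega)
  omega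

lemma R4_half1 {m : ℤ} (hm : m % 4 = 1) :
    Finset.card ((R4 m).filter (fun p => (p.2.1 + 2 * (p.1 + p.2.2.1 + p.2.2.2)) % 4 = 1)) = Finset.card (Q4 (4 * m)) := by
  refine Finset.card_nbij' (fun p => (p.2.1 + 2 * p.1 + 2 * p.2.2.1 + 2 * p.2.2.2,
      p.2.1 + 2 * p.1 - 2 * p.2.2.1 - 2 * p.2.2.2, p.2.1 - 2 * p.1 + 2 * p.2.2.1 - 2 * p.2.2.2,
      p.2.1 - 2 * p.1 - 2 * p.2.2.1 + 2 * p.2.2.2))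
    (fun p => ((p.1 + p.2.1 - p.2.2.1 - p.2.2.2) / 8, (p.1 + p.2.1 + p.2.2.1 + p.2.2.2) / 4,
      (p.1 - p.2.1 + p.2.2.1 - p.2.2.2) / 8, (p.1 - p.2.1 - p.2.2.1 + p.2.2.2) / 8)) ?_ ?_ ?_ ?_
  · rintro ⟨w, u, v, z⟩
    simp only [Finset.mem_coe, Finset.mem_filter, mem_R4, mem_Q4]
    rintro ⟨h, h1⟩
    exact ⟨by omega, by omega, by omega, by omega, by rw [← h]; ring⟩
  · rintro ⟨x, y, z, w⟩
    simp only [Finset.mem_coe, Finset.mem_filter, mem_R4, mem_Q4]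
    rintro ⟨h1, h2, h3, h4, h⟩
    obtain ⟨a, rfl⟩ : ∃ a, x = 4 * a + 1 := ⟨x / 4, by omega⟩
    obtain ⟨b, rfl⟩ : ∃ a, y = 4 * a + 1 := ⟨y / 4, by omega⟩
    obtain ⟨c, rfl⟩ : ∃ a, z = 4 * a + 1 := ⟨z / 4, by omega⟩
    obtain ⟨d, rfl⟩ : ∃ a, w = 4 * a + 1 := ⟨w / 4, by omega⟩
    have hq : 16 * (a ^ 2 + b ^ 2 + c ^ 2 + d ^ 2) + 8 * (a + b + c + d) + 4 = 4 * m := by rw [← h]; ring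
    have hs : (a + b + c + d) % 2 = 0 := by omega
    obtain ⟨e, he⟩ : ∃ e, a + b + c + d = 2 * e := ⟨(a + b + c + d) / 2, by omega⟩
    obtain rfl : d = 2 * e - a - b - c := by linarith
    have e1 : (4 * a + 1 + (4 * b + 1) - (4 * c + 1) - (4 * (2 * e - a - b - c) + 1)) / 8 = a + b - e := by omega
    have e2 : (4 * a + 1 + (4 * b + 1) + (4 * c + 1) + (4 * (2 * e - a - b - c) + 1)) / 4 = 2 * e + 1 := by omega
    have e3 : (4 * a + 1 - (4 * b + 1) + (4 * c + 1) - (4 * (2 * e - a - b - c) + 1)) / 8 = a + c - e := by omega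
    have e4 : (4 * a + 1 - (4 * b + 1) - (4 * c + 1) + (4 * (2 * e - a - b - c) + 1)) / 8 = e - b - c := by omega
    rw [e1, e2, e3, e4]
    refine ⟨by linarith, by omega⟩
  · rintro ⟨w, u, v, z⟩ _
    simp only [Prod.mk.injEq]
    refine ⟨by omega, by omega, by omega, by omega⟩
  · rintro ⟨x, y, z, w⟩
    simp only [Finset.mem_coe, mem_Q4]
    rintro ⟨h1, h2, h3, h4, h⟩
    obtain ⟨a, rfl⟩ : ∃ a, x = 4 * a + 1 := ⟨x / 4, by omega⟩
    obtain ⟨b, rfl⟩ : ∃ a, y = 4 * a + 1 := ⟨y / 4, by omega⟩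
    obtain ⟨c, rfl⟩ : ∃ a, z = 4 * a + 1 := ⟨z / 4, by omega⟩
    obtain ⟨d, rfl⟩ : ∃ a, w = 4 * a + 1 := ⟨w / 4, by omega⟩
    have hq : 16 * (a ^ 2 + b ^ 2 + c ^ 2 + d ^ 2) + 8 * (a + b + c + d) + 4 = 4 * m := by rw [← h]; ring
    have hs : (a + b + c + d) % 2 = 0 := by omega
    obtain ⟨e, he⟩ : ∃ e, a + b + c + d = 2 * e := ⟨(a + b + c + d) / 2, by omega⟩
    obtain rfl : d = 2 * e - a - b - c := by linarith
    have e1 : (4 * a + 1 + (4 * b + 1) - (4 * c + 1) - (4 * (2 * e - a - b - c) + 1)) / 8 = a + b - e := by omega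
    have e2 : (4 * a + 1 + (4 * b + 1) + (4 * c + 1) + (4 * (2 * e - a - b - c) + 1)) / 4 = 2 * e + 1 := by omega
    have e3 : (4 * a + 1 - (4 * b + 1) + (4 * c + 1) - (4 * (2 * e - a - b - c) + 1)) / 8 = a + c - e := by omega
    have e4 : (4 * a + 1 - (4 * b + 1) - (4 * c + 1) + (4 * (2 * e - a - b - c) + 1)) / 8 = e - b - c := by omega
    rw [e1, e2, e3, e4]
    simp only [Prod.mk.injEq]
    refine ⟨by ring, by ring, by ring, by ring⟩

lemma R4_half2 {m : ℤ} (hm : m % 4 = 1) :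
    Finset.card ((R4 m).filter (fun p => (p.2.1 + 2 * (p.1 + p.2.2.1 + p.2.2.2)) % 4 = 1))
     = Finset.card ((R4 m).filter (fun p => ¬ (p.2.1 + 2 * (p.1 + p.2.2.1 + p.2.2.2)) % 4 = 1)) := by
  refine Finset.card_nbij' (fun p => (p.1, -p.2.1, p.2.2)) (fun p => (p.1, -p.2.1, p.2.2)) ?_ ?_ ?_ ?_
  · rintro ⟨w, u, v, z⟩
    simp only [Finset.mem_coe, Finset.mem_filter, mem_R4]
    rintro ⟨h, h1⟩
    have := R4_odd hm h
    exact ⟨by linarith, by omega⟩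
  · rintro ⟨w, u, v, z⟩
    simp only [Finset.mem_coe, Finset.mem_filter, mem_R4]
    rintro ⟨h, h1⟩
    have := R4_odd hm h
    exact ⟨by linarith, by omega⟩
  · rintro ⟨w, u, v, z⟩ _; simp
  · rintro ⟨w, u, v, z⟩ _; simp

lemma R4_card {m : ℤ} (hm : m % 4 = 1) : (Finset.card (R4 m) : ℤ) = 2 * ∑ q ∈ Pr 1 m, q.1 := by
  have h1 := R4_half1 hm
  have h2 := R4_half2 hm
  have h3 := r4_four (K := 4 * m) (by omega)
  rw [Pr_scale (by norm_num)] at h3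
  have h4 := Finset.card_filter_add_card_filter_not (s := R4 m) (fun p => (p.2.1 + 2 * (p.1 + p.2.2.1 + p.2.2.2)) % 4 = 1)
  rw [← h3]
  omega

lemma sum_Pr_divisors (m : ℕ) (hm : 0 < m) : ∑ q ∈ Pr 1 (m : ℤ), q.1 = ∑ d ∈ m.divisors, (d : ℤ) := by
  refine Finset.sum_nbij' (fun q => q.1.toNat) (fun d => ((d : ℤ), ((m / d : ℕ) : ℤ))) ?_ ?_ ?_ ?_ ?_
  · rintro ⟨d, e⟩
    simp only [mem_Pr one_pos, Nat.mem_divisors]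
    rintro ⟨h1, h2, h3⟩
    lift d to ℕ using h1.le
    lift e to ℕ using h2.le
    rw [Int.toNat_natCast]
    exact ⟨⟨e, by exact_mod_cast (by linarith : (m : ℤ) = d * e)⟩, hm.ne'⟩
  · intro d
    simp only [mem_Pr one_pos, Nat.mem_divisors]
    rintro ⟨⟨e, rfl⟩, h⟩
    have hd : 0 < d := Nat.pos_of_mul_pos_right hm
    have he : 0 < e := Nat.pos_of_mul_pos_left hm
    rw [Nat.mul_div_cancel_left _ hd]
    push_cast
    exact ⟨by exact_mod_cast hd, by exact_mod_cast he, by ring⟩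
  · rintro ⟨d, e⟩
    simp only [mem_Pr one_pos]
    rintro ⟨h1, h2, h3⟩
    lift d to ℕ using h1.le
    lift e to ℕ using h2.le
    rw [Int.toNat_natCast]
    have : m = d * e := by exact_mod_cast (by linarith : (m : ℤ) = d * e)
    rw [this, Nat.mul_div_cancel_left _ (by exact_mod_cast h1)]
  · intro d _; simp
  · rintro ⟨d, e⟩
    simp only [mem_Pr one_pos]
    rintro ⟨h1, h2, h3⟩
    rw [Int.toNat_of_nonneg h1.le]


/-! ### ternary sum -/

noncomputable def K3 (M : ℤ) : Finset (ℤ × ℤ × ℤ) :=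
  (bx M ×ˢ bx M ×ˢ bx M).filter (fun p => p.1 ^ 2 + 4 * p.2.1 ^ 2 + 4 * p.2.2 ^ 2 = M)

lemma mem_K3 {M u v z : ℤ} : (u, v, z) ∈ K3 M ↔ u ^ 2 + 4 * v ^ 2 + 4 * z ^ 2 = M := by
  unfold K3
  simp only [Finset.mem_filter, Finset.mem_product]
  refine ⟨fun h => h.2, fun h => ⟨⟨mem_bx_of_sq ?_, mem_bx_of_sq ?_, mem_bx_of_sq ?_⟩, h⟩⟩ <;>
    linarith [sq_nonneg u, sq_nonneg v, sq_nonneg z]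

noncomputable def E3 (M : ℤ) : Finset (ℤ × ℤ × ℤ) :=
  (bx M ×ˢ bx M ×ˢ bx M).filter (fun p => p.1 ^ 2 + 8 * (p.2.1 ^ 2 + p.2.2 ^ 2) = M)

lemma mem_E3 {M u v z : ℤ} : (u, v, z) ∈ E3 M ↔ u ^ 2 + 8 * (v ^ 2 + z ^ 2) = M := by
  unfold E3
  simp only [Finset.mem_filter, Finset.mem_product]
  refine ⟨fun h => h.2, fun h => ⟨⟨mem_bx_of_sq ?_, mem_bx_of_sq ?_, mem_bx_of_sq ?_⟩, h⟩⟩ <;>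
    linarith [sq_nonneg u, sq_nonneg v, sq_nonneg z]

lemma K3_odd (M : ℤ) : ∑ p ∈ (K3 M).filter (fun p => ¬ (p.2.1 + p.2.2) % 2 = 0), sg p.2.1 = 0 := by
  have h : ∑ p ∈ (K3 M).filter (fun p => ¬ (p.2.1 + p.2.2) % 2 = 0), sg p.2.1
      = ∑ p ∈ (K3 M).filter (fun p => ¬ (p.2.1 + p.2.2) % 2 = 0), - sg p.2.1 := by
    refine Finset.sum_nbij' (fun p => (p.1, p.2.2, p.2.1)) (fun p => (p.1, p.2.2, p.2.1)) ?_ ?_ ?_ ?_ ?_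
    · rintro ⟨u, v, z⟩
      simp only [Finset.mem_filter, mem_K3]
      rintro ⟨h, h1⟩; exact ⟨by linarith, by omega⟩
    · rintro ⟨u, v, z⟩
      simp only [Finset.mem_filter, mem_K3]
      rintro ⟨h, h1⟩; exact ⟨by linarith, by omega⟩
    · rintro ⟨u, v, z⟩ _; rfl
    · rintro ⟨u, v, z⟩ _; rfl
    · rintro ⟨u, v, z⟩
      simp only [Finset.mem_filter, mem_K3]
      rintro ⟨h, h1⟩
      exact sg_anti (by omega)
  rw [Finset.sum_neg_distrib] at h
  linarith

lemma K3_even (M : ℤ) : ∑ p ∈ (K3 M).filter (fun p => (p.2.1 + p.2.2) % 2 = 0), sg p.2.1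
    = ∑ p ∈ E3 M, sg (p.2.1 + p.2.2) := by
  refine Finset.sum_nbij' (fun p => (p.1, (p.2.1 + p.2.2) / 2, (p.2.1 - p.2.2) / 2))
    (fun p => (p.1, p.2.1 + p.2.2, p.2.1 - p.2.2)) ?_ ?_ ?_ ?_ ?_
  · rintro ⟨u, v, z⟩
    simp only [Finset.mem_filter, mem_K3, mem_E3]
    rintro ⟨h, h1⟩
    obtain ⟨a, ha⟩ : ∃ a, v + z = 2 * a := ⟨(v + z) / 2, by omega⟩
    obtain rfl : z = 2 * a - v := by linarith
    have e1 : (v + (2 * a - v)) / 2 = a := by omega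
    have e2 : (v - (2 * a - v)) / 2 = v - a := by omega
    rw [e1, e2]; linarith
  · rintro ⟨u, a, b⟩
    simp only [Finset.mem_filter, mem_K3, mem_E3]
    intro h
    exact ⟨by linarith, by omega⟩
  · rintro ⟨u, v, z⟩
    simp only [Finset.mem_filter, mem_K3, Prod.mk.injEq]
    rintro ⟨h, h1⟩
    refine ⟨trivial, by omega, by omega⟩
  · rintro ⟨u, a, b⟩ _
    simp only [Prod.mk.injEq]
    refine ⟨trivial, by omega, by omega⟩
  · rintro ⟨u, v, z⟩
    simp only [Finset.mem_filter, mem_K3]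
    rintro ⟨h, h1⟩
    congr 1; omega

noncomputable def F2 (K : ℤ) : Finset (ℤ × ℤ) :=
  (bx K ×ˢ bx K).filter (fun p => 8 * (p.1 ^ 2 + p.2 ^ 2) = K)

lemma mem_F2 {K x y : ℤ} : (x, y) ∈ F2 K ↔ 8 * (x ^ 2 + y ^ 2) = K := by
  unfold F2
  simp only [Finset.mem_filter, Finset.mem_product]
  refine ⟨fun h => h.2, fun h => ⟨⟨mem_bx_of_sq ?_, mem_bx_of_sq ?_⟩, h⟩⟩ <;>
    nlinarith [sq_nonneg x, sq_nonneg y]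

lemma sum_E3 (M : ℤ) (f : ℤ × ℤ → ℤ) :
    ∑ p ∈ E3 M, f p.2 = ∑ u ∈ bx M, ∑ q ∈ F2 (M - u ^ 2), f q := by
  refine Finset.sum_finset_product _ _ _ ?_ (f := fun p => f p.2)
  rintro ⟨u, a, b⟩
  rw [mem_E3, mem_F2]
  constructor
  · intro h; exact ⟨mem_bx_of_sq (by linarith [sq_nonneg a, sq_nonneg b]), by linarith⟩
  · rintro ⟨_, h⟩; linarith

lemma sq_par (a : ℤ) : (a ^ 2 - a) % 2 = 0 := by
  have : a ^ 2 - a = a * (a - 1) := by ring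
  rw [this]
  exact Int.even_iff.1 (Int.even_mul_pred_self a)

lemma F2_inner (K : ℤ) : ∑ q ∈ F2 K, sg (q.1 + q.2) =
    (if K = 0 then 1 else 0) + 4 * ∑ q ∈ Pr 8 K, sg q.2 * chi q.1 := by
  have h8 : (0 : ℤ) < 8 := by norm_num
  by_cases hK : K % 8 = 0
  · obtain ⟨k, rfl⟩ : ∃ k, K = 8 * k := ⟨K / 8, by omega⟩
    have hF : F2 (8 * k) = Q2 k := by
      ext ⟨x, y⟩
      rw [mem_F2, mem_Q2]; omega
    rw [hF, Pr_scale h8]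
    have hs : ∀ q ∈ Q2 k, sg (q.1 + q.2) = sg k := by
      rintro ⟨x, y⟩ h
      rw [mem_Q2] at h
      apply sg_congr
      have := sq_par x
      have := sq_par y
      simp only
      omega
    rw [Finset.sum_congr rfl hs, Finset.sum_const, nsmul_eq_mul]
    rcases lt_trichotomy k 0 with hk | hk | hk
    · rw [Q2_neg hk, Pr_empty one_pos hk.le, if_neg (by omega)]; simp
    · subst hk
      rw [Pr_empty one_pos le_rfl, if_pos (by norm_num)]
      have : Q2 0 = {(0, 0)} := by
        ext ⟨x, y⟩
        rw [mem_Q2]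
        simp only [Finset.mem_singleton, Prod.mk.injEq]
        constructor
        · intro h
          exact ⟨pow_eq_zero_iff (two_ne_zero) |>.1 (by nlinarith [sq_nonneg x, sq_nonneg y]),
            pow_eq_zero_iff (two_ne_zero) |>.1 (by nlinarith [sq_nonneg x, sq_nonneg y])⟩
        · rintro ⟨rfl, rfl⟩; norm_num
      rw [this]; simp [sg]
    · rw [r2_formula hk, if_neg (by omega), zero_add, mul_assoc, Finset.sum_mul]
      congr 1
      refine Finset.sum_congr rfl ?_
      rintro ⟨d, e⟩ h
      rw [mem_Pr one_pos] at h
      obtain ⟨_, _, h⟩ := h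
      simp only
      by_cases hd : d % 2 = 1
      · rw [mul_comm]; congr 1
        apply sg_congr
        rw [← h]
        obtain ⟨c, rfl⟩ : ∃ c, d = 2 * c + 1 := ⟨d / 2, by omega⟩
        have : 1 * ((2 * c + 1) * e) - e = 2 * (c * e) := by ring
        rw [this]; omega
      · rw [chi_even hd]; ring
  · have h1 : F2 K = ∅ := by
      apply Finset.eq_empty_of_forall_notMem
      rintro ⟨x, y⟩ h; rw [mem_F2] at h; omega
    have h2 : Pr 8 K = ∅ := by
      apply Finset.eq_empty_of_forall_notMem
      rintro ⟨x, y⟩ h; rw [mem_Pr h8] at h; omega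
    rw [h1, h2, if_neg (by rintro rfl; omega)]; simp

lemma K3_total (M : ℤ) : ∑ p ∈ K3 M, sg p.2.1 =
    (Finset.card ((bx M).filter (fun u => u ^ 2 = M)) : ℤ) + 4 * ∑ p ∈ T 8 M, sg p.2.2 * chi p.2.1 := by
  rw [← Finset.sum_filter_add_sum_filter_not (K3 M) (fun p => (p.2.1 + p.2.2) % 2 = 0), K3_odd, K3_even,
    add_zero, sum_E3 M (fun q => sg (q.1 + q.2)), sum_T (by norm_num)]
  simp only [F2_inner]
  rw [Finset.sum_add_distrib, Finset.mul_sum, ← Finset.sum_filter, Finset.sum_const, nsmul_eq_mul, mul_one]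
  congr 3
  refine Finset.filter_congr ?_
  intro u _
  constructor <;> intro h <;> linarith

lemma KM {M : ℤ} (hM : M % 4 = 1) : ∑ p ∈ K3 M, sg p.2.1 =
    2 * ∑ x ∈ (bx M).filter (fun x => x % 4 = 1 ∧ x ^ 2 = M), x := by
  rw [K3_total]
  by_cases h : ∀ x : ℤ, x ^ 2 ≠ M
  · rw [L8_nonsq (by omega) h, Finset.filter_false_of_mem (fun x _ => h x),
      Finset.filter_false_of_mem (fun x _ hx => h x hx.2)]
    simp
  · push Not at h
    obtain ⟨X, hX⟩ : ∃ X : ℤ, 0 < X ∧ X ^ 2 = M := by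
      obtain ⟨x, hx⟩ := h
      refine ⟨|x|, ?_, by rw [sq_abs, hx]⟩
      rw [abs_pos]; rintro rfl; omega
    obtain ⟨h0, hX⟩ := hX
    have ho : X % 2 = 1 := by
      by_contra h5
      have := sq_even_mod4 (x := X) (by omega)
      omega
    subst hX
    have h8 := L8_sq ho h0
    have c1 : (bx (X ^ 2)).filter (fun u => u ^ 2 = X ^ 2) = {X, -X} := by
      ext u
      simp only [Finset.mem_filter, Finset.mem_insert, Finset.mem_singleton]
      rw [sq_eq_sq_iff_eq_or_eq_neg]
      refine ⟨fun h => h.2, fun h => ⟨mem_bx_of_sq ?_, h⟩⟩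
      rcases h with rfl | rfl <;> simp
    have c2 : (bx (X ^ 2)).filter (fun u => u % 4 = 1 ∧ u ^ 2 = X ^ 2) = {chi X * X} := by
      ext u
      simp only [Finset.mem_filter, Finset.mem_singleton]
      rw [sq_eq_sq_iff_eq_or_eq_neg]
      have : (u % 4 = 1 ∧ (u = X ∨ u = -X)) ↔ u = chi X * X := by
        unfold chi
        split_ifs <;> omega
      rw [this]
      refine ⟨fun h => h.2, fun h => ⟨mem_bx_of_sq ?_, h⟩⟩
      rw [← this] at h
      rcases h.2 with rfl | rfl <;> simp
    rw [c1, c2, Finset.sum_singleton, Finset.card_pair (by omega)]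
    push_cast
    linarith

/-! ### grouping -/

noncomputable def S2 (m : ℤ) : Finset (ℤ × ℤ) :=
  (bx m ×ˢ bx m).filter (fun p => p.1 % 4 = 1 ∧ p.1 ^ 2 + 4 * p.2 ^ 2 = m)

lemma mem_S2 {m x y : ℤ} : (x, y) ∈ S2 m ↔ x % 4 = 1 ∧ x ^ 2 + 4 * y ^ 2 = m := by
  unfold S2
  simp only [Finset.mem_filter, Finset.mem_product]
  refine ⟨fun h => h.2, fun h => ⟨⟨mem_bx_of_sq ?_, mem_bx_of_sq ?_⟩, h⟩⟩ <;>
    nlinarith [sq_nonneg x, sq_nonneg y, h.2]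

lemma R4_sg_v {m : ℤ} (hm : m % 4 = 1) : ∑ p ∈ R4 m, sg p.2.2.1 = 2 * ∑ p ∈ S2 m, p.1 := by
  have h1 : ∑ p ∈ R4 m, sg p.2.2.1 = ∑ w ∈ bx m, ∑ q ∈ K3 (m - 4 * w ^ 2), sg q.2.1 := by
    refine Finset.sum_finset_product _ _ _ ?_ (f := fun p : ℤ × ℤ × ℤ × ℤ => sg p.2.2.1)
    rintro ⟨w, u, v, z⟩
    rw [mem_R4, mem_K3]
    constructor
    · intro h
      exact ⟨mem_bx_of_sq (by linarith [sq_nonneg u, sq_nonneg v, sq_nonneg z, sq_nonneg w]), by linarith⟩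
    · rintro ⟨_, h⟩; linarith
  have h2 : ∑ p ∈ S2 m, p.1 = ∑ w ∈ bx m, ∑ x ∈ (bx (m - 4 * w ^ 2)).filter (fun x => x % 4 = 1 ∧ x ^ 2 = m - 4 * w ^ 2), x := by
    refine Finset.sum_finset_product_right _ _ _ ?_ (f := fun p : ℤ × ℤ => p.1)
    rintro ⟨x, w⟩
    rw [mem_S2, Finset.mem_filter]
    constructor
    · rintro ⟨h, h'⟩
      exact ⟨mem_bx_of_sq (by linarith [sq_nonneg x, sq_nonneg w]), mem_bx_of_sq (by simp only; linarith), h, by simp only; linarith⟩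
    · rintro ⟨_, _, h, h'⟩; exact ⟨h, by simp only at h'; linarith⟩
  rw [h1, h2, Finset.mul_sum]
  refine Finset.sum_congr rfl ?_
  intro w _
  exact KM (by omega)

lemma R4_sg_w (m : ℤ) : ∑ p ∈ R4 m, sg p.1 = ∑ p ∈ R4 m, sg p.2.2.1 := by
  refine Finset.sum_nbij' (fun p => (p.2.2.1, p.2.1, p.1, p.2.2.2)) (fun p => (p.2.2.1, p.2.1, p.1, p.2.2.2)) ?_ ?_ ?_ ?_ ?_ <;>
  rintro ⟨w, u, v, z⟩ h
  · rw [mem_R4] at h ⊢; simp only; linarith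
  · rw [mem_R4] at h ⊢; simp only; linarith
  all_goals rfl

lemma R4_sg_z (m : ℤ) : ∑ p ∈ R4 m, sg p.2.2.2 = ∑ p ∈ R4 m, sg p.2.2.1 := by
  refine Finset.sum_nbij' (fun p => (p.1, p.2.1, p.2.2.2, p.2.2.1)) (fun p => (p.1, p.2.1, p.2.2.2, p.2.2.1)) ?_ ?_ ?_ ?_ ?_ <;>
  rintro ⟨w, u, v, z⟩ h
  · rw [mem_R4] at h ⊢; simp only; linarith
  · rw [mem_R4] at h ⊢; simp only; linarith
  all_goals rfl

noncomputable def RO (m : ℤ) : Finset (ℤ × ℤ × ℤ × ℤ) := (R4 m).filter (fun p => p.1 % 2 = 1 ∧ p.2.2.2 % 2 = 1)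

lemma four_RO {n m : ℤ} (hm : m = 4 * n + 9) :
    4 * (Finset.card (RO m) : ℤ) = 2 * ∑ q ∈ Pr 1 m, q.1 - (2 - sg n) * (2 * ∑ p ∈ S2 m, p.1) := by
  have hm4 : m % 4 = 1 := by omega
  have h1 : 4 * (Finset.card (RO m) : ℤ) = ∑ p ∈ R4 m, (1 - sg p.1 - sg p.2.2.2 + sg n * sg p.2.2.1) := by
    unfold RO
    rw [Finset.card_eq_sum_ones, Finset.sum_filter]
    push_cast
    rw [Finset.mul_sum]
    refine Finset.sum_congr rfl ?_
    rintro ⟨w, u, v, z⟩ h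
    rw [mem_R4] at h
    have hu := sq_odd_mod8 (R4_odd hm4 h)
    have a1 := sq_par w
    have a2 := sq_par v
    have a3 := sq_par z
    simp only
    unfold sg
    split_ifs <;> omega
  rw [h1, Finset.sum_add_distrib, Finset.sum_sub_distrib, Finset.sum_sub_distrib, ← Finset.mul_sum, R4_sg_w, R4_sg_z,
    R4_sg_v hm4, Finset.sum_const, nsmul_eq_mul, R4_card hm4]
  ring

noncomputable def Y (m : ℤ) : Finset (ℤ × ℤ × ℤ × ℤ) :=
  (bx m ×ˢ bx m ×ˢ bx m ×ˢ bx m).filter (fun p =>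
    (p.2.2.1 % 2 = 1 ∧ p.2.2.2 % 2 = 1) ∧ p.1 ^ 2 + p.2.1 ^ 2 + 4 * p.2.2.1 ^ 2 + 4 * p.2.2.2 ^ 2 = m)

lemma mem_Y {m a b z w : ℤ} : (a, b, z, w) ∈ Y m ↔
    (z % 2 = 1 ∧ w % 2 = 1) ∧ a ^ 2 + b ^ 2 + 4 * z ^ 2 + 4 * w ^ 2 = m := by
  unfold Y
  simp only [Finset.mem_filter, Finset.mem_product]
  refine ⟨fun h => h.2, fun h => ⟨⟨mem_bx_of_sq ?_, mem_bx_of_sq ?_, mem_bx_of_sq ?_, mem_bx_of_sq ?_⟩, h⟩⟩ <;>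
    linarith [sq_nonneg a, sq_nonneg b, sq_nonneg z, sq_nonneg w, h.2]

lemma Y_par {m a b k : ℤ} (hm : m % 4 = 1) (h : a ^ 2 + b ^ 2 + 4 * k = m) : (a + b) % 2 = 1 := by
  have := sq_par a
  have := sq_par b
  omega

lemma mem_RO {m w u v z : ℤ} : (w, u, v, z) ∈ RO m ↔
    4 * w ^ 2 + u ^ 2 + 4 * v ^ 2 + 4 * z ^ 2 = m ∧ w % 2 = 1 ∧ z % 2 = 1 := by
  unfold RO
  rw [Finset.mem_filter, mem_R4]

lemma Y_card1 {m : ℤ} (hm : m % 4 = 1) :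
    Finset.card ((Y m).filter (fun p => p.1 % 2 = 1)) = Finset.card (RO m) := by
  refine Finset.card_nbij' (fun p => (p.2.2.1, p.1, p.2.1 / 2, p.2.2.2)) (fun p => (p.2.1, 2 * p.2.2.1, p.1, p.2.2.2)) ?_ ?_ ?_ ?_
  · rintro ⟨a, b, z, w⟩
    simp only [Finset.mem_coe, Finset.mem_filter, mem_Y, mem_RO]
    rintro ⟨⟨h1, h⟩, ha⟩
    have := Y_par (a := a) (b := b) (k := z ^ 2 + w ^ 2) hm (by linarith)
    obtain ⟨c, rfl⟩ : ∃ c, b = 2 * c := ⟨b / 2, by omega⟩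
    rw [Int.mul_ediv_cancel_left _ two_ne_zero]
    exact ⟨by linarith, h1⟩
  · rintro ⟨w, u, v, z⟩
    simp only [Finset.mem_coe, Finset.mem_filter, mem_Y, mem_RO]
    rintro ⟨h, h1⟩
    exact ⟨⟨h1, by linarith⟩, R4_odd hm h⟩
  · rintro ⟨a, b, z, w⟩
    simp only [Finset.mem_coe, Finset.mem_filter, mem_Y, Prod.mk.injEq]
    rintro ⟨⟨h1, h⟩, ha⟩
    have := Y_par (a := a) (b := b) (k := z ^ 2 + w ^ 2) hm (by linarith)
    refine ⟨trivial, ?_, trivial⟩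
    omega
  · rintro ⟨w, u, v, z⟩ _
    simp only [Prod.mk.injEq]
    refine ⟨trivial, trivial, by omega, trivial⟩

lemma Y_card2 {m : ℤ} (hm : m % 4 = 1) :
    Finset.card ((Y m).filter (fun p => p.1 % 2 = 1)) = Finset.card ((Y m).filter (fun p => ¬ p.1 % 2 = 1)) := by
  refine Finset.card_nbij' (fun p => (p.2.1, p.1, p.2.2)) (fun p => (p.2.1, p.1, p.2.2)) ?_ ?_ ?_ ?_
  · rintro ⟨a, b, z, w⟩
    simp only [Finset.mem_coe, Finset.mem_filter, mem_Y]
    rintro ⟨⟨h1, h⟩, ha⟩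
    have := Y_par (a := a) (b := b) (k := z ^ 2 + w ^ 2) hm (by linarith)
    exact ⟨⟨h1, by linarith⟩, by omega⟩
  · rintro ⟨a, b, z, w⟩
    simp only [Finset.mem_coe, Finset.mem_filter, mem_Y]
    rintro ⟨⟨h1, h⟩, ha⟩
    have := Y_par (a := a) (b := b) (k := z ^ 2 + w ^ 2) hm (by linarith)
    exact ⟨⟨h1, by linarith⟩, by omega⟩
  · rintro ⟨a, b, z, w⟩ _; rfl
  · rintro ⟨a, b, z, w⟩ _; rfl

lemma Y_card {m : ℤ} (hm : m % 4 = 1) : Finset.card (Y m) = 2 * Finset.card (RO m) := by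
  have h := Finset.card_filter_add_card_filter_not (s := Y m) (fun p => p.1 % 2 = 1)
  rw [← h, ← Y_card2 hm, Y_card1 hm]; ring

lemma tri (x : ℤ) : 2 * (x * (x - 1) / 2) = x * (x - 1) :=
  Int.mul_ediv_cancel' (Int.even_mul_pred_self x).two_dvd

lemma sg_pow (n : ℕ) : ((-1) ^ n : ℤ) = sg n := by
  unfold sg
  split_ifs with h
  · exact Even.neg_one_pow (by rw [Nat.even_iff]; omega)
  · exact Odd.neg_one_pow (by rw [Nat.odd_iff]; omega)

lemma t_card (n : ℕ) : t 1 1 8 8 n = Finset.card (Y (4 * n + 9)) := by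
  unfold t
  rw [← Set.ncard_coe_finset]
  refine Set.ncard_congr (fun P _ => (P.1 + P.2.1 - 1, P.1 - P.2.1, 2 * P.2.2.1 - 1, 2 * P.2.2.2 - 1)) ?_ ?_ ?_
  · rintro ⟨x, y, z, w⟩ h
    simp only [Set.mem_ofPred_eq] at h
    rw [Finset.mem_coe, mem_Y]
    push_cast at h
    have := tri x
    have := tri y
    have := tri z
    have := tri w
    refine ⟨⟨by simp only; omega, by simp only; omega⟩, ?_⟩
    simp only
    linarith
  · rintro ⟨x, y, z, w⟩ ⟨x', y', z', w'⟩ _ _ h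
    simp only [Prod.mk.injEq] at h ⊢
    omega
  · rintro ⟨a, b, z, w⟩ h
    rw [Finset.mem_coe, mem_Y] at h
    obtain ⟨⟨hz, hw⟩, h⟩ := h
    have hp := Y_par (a := a) (b := b) (k := z ^ 2 + w ^ 2) (m := 4 * n + 9) (by omega) (by linarith)
    obtain ⟨x, hx⟩ : ∃ x, a + b = 2 * x - 1 := ⟨(a + b + 1) / 2, by omega⟩
    obtain ⟨Z, rfl⟩ : ∃ x, z = 2 * x - 1 := ⟨(z + 1) / 2, by omega⟩
    obtain ⟨W, rfl⟩ : ∃ x, w = 2 * x - 1 := ⟨(w + 1) / 2, by omega⟩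
    obtain rfl : a = 2 * x - 1 - b := by linarith
    refine ⟨(x, x - b, Z, W), ?_, ?_⟩
    · simp only [Set.mem_ofPred_eq]
      push_cast
      have := tri x
      have := tri (x - b)
      have := tri Z
      have := tri W
      linarith
    · simp only [Prod.mk.injEq]
      refine ⟨by ring, by ring, trivial⟩

theorem stmt12 (n : ℕ) (hn : 0 < n) :
    (t 1 1 8 8 n : ℤ) = (∑ d ∈ (4 * n + 9).divisors, (d : ℤ))
      - (2 - (-1) ^ n) *
        ∑ᶠ P ∈ {P : ℤ × ℤ | P.1 % 4 = 1 ∧ (4 * n + 9 : ℤ) = P.1 ^ 2 + 4 * P.2 ^ 2}, P.1 := by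
  have hs : {P : ℤ × ℤ | P.1 % 4 = 1 ∧ (4 * n + 9 : ℤ) = P.1 ^ 2 + 4 * P.2 ^ 2} = ↑(S2 (4 * n + 9)) := by
    ext ⟨x, y⟩
    rw [Finset.mem_coe, mem_S2, Set.mem_ofPred_eq]
    simp only [eq_comm]
  rw [hs, finsum_mem_coe_finset, ← sum_Pr_divisors _ (by omega), t_card, Y_card (by omega), sg_pow]
  have h := four_RO (n := (n : ℤ)) (m := 4 * n + 9) rfl
  push_cast
  linarith
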